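/- Let g be a nonnegative multiplicative function with g(n) ≪ n^α for some α < 1/2 and ∑_{p≤w} g(p)(log p)/p = κ log w + O(1) for a real κ ≥ 0 and all w ≥ 2. Then ∑_{n≤x} g(n)/n = c(g)(log x)^κ + O((log x)^{κ−1}) for all x ≥ 2, where c(g) = Γ(κ+1)^{-1} ∏_p (1−1/p)^κ (1 + g(p)/p + g(p²)/p² + ⋯). -/

import Mathlib

open Finset Filter

theorem sum_Ioc_sum_divisorsAntidiagonal (F : ℕ → ℕ → ℝ) (N : ℕ) :
    ∑ n ∈ Ioc 0 N, ∑ x ∈ n.divisorsAntidiagonal, F x.1 x.2 =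
      ∑ m ∈ Ioc 0 N, ∑ q ∈ Ioc 0 (N / m), F m q := by
  rw [Finset.sum_sigma', Finset.sum_sigma']
  refine Finset.sum_nbij' (fun y => ⟨y.2.1, y.2.2⟩) (fun y => ⟨y.1 * y.2, (y.1, y.2)⟩) ?_ ?_ ?_ ?_ ?_
  · rintro ⟨n, m, q⟩ h
    simp only [mem_sigma, mem_Ioc, Nat.mem_divisorsAntidiagonal] at h ⊢
    obtain ⟨⟨h1, h2⟩, rfl, h3⟩ := h
    have hm : 0 < m := Nat.pos_of_ne_zero (by rintro rfl; simp at h1)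
    have hq : 0 < q := Nat.pos_of_ne_zero (by rintro rfl; simp at h1)
    refine ⟨⟨hm, le_trans (Nat.le_mul_of_pos_right _ hq) h2⟩, hq, ?_⟩
    rw [Nat.le_div_iff_mul_le hm, mul_comm]; exact h2
  · rintro ⟨m, q⟩ h
    simp only [mem_sigma, mem_Ioc, Nat.mem_divisorsAntidiagonal] at h ⊢
    obtain ⟨⟨h1, h2⟩, h3, h4⟩ := h
    rw [Nat.le_div_iff_mul_le h1, mul_comm] at h4
    have := Nat.mul_pos h1 h3
    exact ⟨⟨this, h4⟩, trivial, this.ne'⟩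
  · rintro ⟨n, m, q⟩ h
    simp only [mem_sigma, mem_Ioc, Nat.mem_divisorsAntidiagonal] at h ⊢
    obtain ⟨_, rfl, _⟩ := h
    rfl
  · rintro ⟨m, q⟩ _; rfl
  · rintro ⟨n, m, q⟩ _; rfl

/-- The proper prime powers have counting exponent `1 / 2`. -/
theorem summable_indicator_proper_primePow_rpow {β : ℝ} (hβ : 1 / 2 < β) :
    Summable (Set.indicator {n : ℕ | IsPrimePow n ∧ ¬ n.Prime} fun n : ℕ => (n : ℝ) ^ (-β)) := by
  rw [← summable_subtype_iff_indicator]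
  have hex : ∀ n : {n : ℕ | IsPrimePow n ∧ ¬ n.Prime},
      ∃ y : ℕ × ℕ, y.1.Prime ∧ (n : ℕ) = y.1 ^ (y.2 + 2) := by
    rintro ⟨n, hn, hnp⟩
    obtain ⟨p, k, hp, hk, rfl⟩ := (isPrimePow_nat_iff _).1 hn
    rcases k with _ | _ | k
    · omega
    · simp [hp] at hnp
    · exact ⟨(p, k), hp, rfl⟩
  choose i hi1 hi2 using hex
  have hinj : Function.Injective i := fun x y h => by
    apply Subtype.ext; rw [hi2 x, hi2 y, h]
  have h2 : (2 : ℝ) ^ (-β) < 1 := Real.rpow_lt_one_of_one_lt_of_neg (by norm_num) (by linarith)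
  have hF : Summable fun y : ℕ × ℕ => (y.1 : ℝ) ^ (-(2 * β)) * ((2 : ℝ) ^ (-β)) ^ y.2 := by
    refine Summable.mul_of_nonneg (f := fun p : ℕ => (p : ℝ) ^ (-(2 * β)))
      (g := fun k : ℕ => ((2 : ℝ) ^ (-β)) ^ k)
      (Real.summable_nat_rpow.2 (by linarith)) (summable_geometric_of_lt_one (by positivity) h2)
      (fun _ => by positivity) (fun _ => by positivity)
  refine Summable.of_nonneg_of_le (fun n => Real.rpow_nonneg (Nat.cast_nonneg _) _) (fun n => ?_) (hF.comp_injective hinj)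
  have hp : (2 : ℝ) ≤ (i n).1 := by exact_mod_cast (hi1 n).two_le
  have hp0 : (0 : ℝ) < (i n).1 := by linarith
  simp only [Function.comp]
  rw [hi2 n, Nat.cast_pow, ← Real.rpow_natCast, ← Real.rpow_mul hp0.le]
  have : ((((i n).2 + 2 : ℕ) : ℝ) * -β) = -(2 * β) + (-β) * ((i n).2 : ℕ) := by push_cast; ring
  rw [this, Real.rpow_add hp0, Real.rpow_mul hp0.le, Real.rpow_natCast]
  gcongr ?_ * ?_ ^ _
  exact Real.rpow_le_rpow_of_nonpos (by norm_num) hp (by linarith)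

theorem sum_le_sum_of_injOn {ι κ : Type*} {s : Finset ι} {t : Finset κ}
    {f : ι → ℝ} {g : κ → ℝ} (i : ι → κ) (hi : ∀ x ∈ s, i x ∈ t) (hinj : Set.InjOn i s)
    (hg : ∀ y ∈ t, 0 ≤ g y) (h : ∀ x ∈ s, f x ≤ g (i x)) : ∑ x ∈ s, f x ≤ ∑ y ∈ t, g y := by
  classical
  calc ∑ x ∈ s, f x ≤ ∑ x ∈ s, g (i x) := Finset.sum_le_sum h
    _ = ∑ y ∈ s.image i, g y := (Finset.sum_image hinj).symm
    _ ≤ ∑ y ∈ t, g y := Finset.sum_le_sum_of_subset_of_nonneg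
        (Finset.image_subset_iff.2 hi) fun y hy _ => hg y hy

theorem mul_log_le_sum_divisorsAntidiagonal {a : ℕ → ℝ}
    (hmul : ∀ m n : ℕ, Nat.Coprime m n → a (m * n) = a m * a n) (hnn : ∀ n, 0 ≤ a n) {n : ℕ}
    (hn : n ≠ 0) :
    a n * Real.log n ≤ ∑ x ∈ n.divisorsAntidiagonal,
      a x.1 * (if IsPrimePow x.2 then a x.2 * Real.log x.2 else 0) := by
  rw [Real.log_nat_eq_sum_factorization, Finsupp.sum, Nat.support_factorization, Finset.mul_sum]
  refine sum_le_sum_of_injOn (fun p => (n / p ^ n.factorization p, p ^ n.factorization p))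
    ?_ ?_ ?_ ?_
  · intro p _
    exact Nat.mem_divisorsAntidiagonal.2
      ⟨Nat.div_mul_cancel (Nat.ordProj_dvd n p), hn⟩
  · intro p hp q hq h
    have hp' := Finset.mem_coe.1 hp
    have hq' := Finset.mem_coe.1 hq
    have hpp := Nat.prime_of_mem_primeFactors hp'
    have hqp := Nat.prime_of_mem_primeFactors hq'
    have hv : n.factorization p ≠ 0 :=
      (hpp.factorization_pos_of_dvd hn (Nat.dvd_of_mem_primeFactors hp')).ne'
    have h2 : p ^ n.factorization p = q ^ n.factorization q := (Prod.ext_iff.1 h).2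
    have : p ∣ q ^ n.factorization q := h2 ▸ dvd_pow_self p hv
    exact (Nat.prime_dvd_prime_iff_eq hpp hqp).1 (hpp.dvd_of_dvd_pow this)
  · intro y _
    refine mul_nonneg (hnn _) ?_
    split_ifs
    · exact mul_nonneg (hnn _) (Real.log_natCast_nonneg _)
    · exact le_rfl
  · intro p hp
    have hpp := Nat.prime_of_mem_primeFactors hp
    have hv : n.factorization p ≠ 0 :=
      (hpp.factorization_pos_of_dvd hn (Nat.dvd_of_mem_primeFactors hp)).ne'
    have hc : Nat.Coprime (n / p ^ n.factorization p) (p ^ n.factorization p) :=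
      (Nat.Coprime.pow_left _ (Nat.coprime_ordCompl hpp hn)).symm
    simp only [if_pos (hpp.isPrimePow.pow hv)]
    have := hmul _ _ hc
    rw [Nat.div_mul_cancel (Nat.ordProj_dvd n p)] at this
    rw [this, Nat.cast_pow, Real.log_pow, mul_assoc]

theorem sum_divisorsAntidiagonal_le_mul_log {a : ℕ → ℝ}
    (hmul : ∀ m n : ℕ, Nat.Coprime m n → a (m * n) = a m * a n) (hnn : ∀ n, 0 ≤ a n) {n : ℕ}
    (hn : n ≠ 0) :
    ∑ x ∈ n.divisorsAntidiagonal,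
      (if x.2.Prime ∧ ¬ x.2 ∣ x.1 then a x.1 * (a x.2 * Real.log x.2) else 0) ≤
    a n * Real.log n := by
  rw [Real.log_nat_eq_sum_factorization, Finsupp.sum, Nat.support_factorization, Finset.mul_sum,
    ← Finset.sum_filter]
  refine sum_le_sum_of_injOn Prod.snd ?_ ?_ ?_ ?_
  · rintro ⟨m, p⟩ h
    simp only [mem_filter, Nat.mem_divisorsAntidiagonal] at h
    exact Nat.mem_primeFactors.2 ⟨h.2.1, Dvd.intro_left _ h.1.1, hn⟩
  · rintro ⟨m, p⟩ h ⟨m', p'⟩ h' (rfl : p = p')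
    simp only [coe_filter, Set.mem_ofPred_eq, Nat.mem_divisorsAntidiagonal] at h h'
    have := h.1.1.trans h'.1.1.symm
    rw [Nat.mul_left_inj h.2.1.ne_zero] at this
    rw [this]
  · intro p _
    exact mul_nonneg (hnn _) (mul_nonneg (Nat.cast_nonneg _) (Real.log_natCast_nonneg _))
  · rintro ⟨m, p⟩ h
    simp only [mem_filter, Nat.mem_divisorsAntidiagonal] at h
    obtain ⟨⟨rfl, -⟩, hp, hpm⟩ := h
    have hv : 1 ≤ (m * p).factorization p :=
      hp.factorization_pos_of_dvd hn (Dvd.intro_left _ rfl)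
    rw [hmul _ _ ((Nat.Prime.coprime_iff_not_dvd hp).2 hpm).symm, mul_assoc]
    refine mul_le_mul_of_nonneg_left (mul_le_mul_of_nonneg_left ?_ (hnn _)) (hnn _)
    exact le_mul_of_one_le_left (Real.log_natCast_nonneg _) (by exact_mod_cast hv)

/-- The multiples of a prime contribute at most the local factor times the full sum. -/
theorem sum_filter_dvd_le {a : ℕ → ℝ}
    (hmul : ∀ m n : ℕ, Nat.Coprime m n → a (m * n) = a m * a n) (hnn : ∀ n, 0 ≤ a n)
    {p : ℕ} (hp : p.Prime) (N : ℕ) :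
    ∑ m ∈ Ioc 0 N with p ∣ m, a m ≤ (∑ s ∈ Ioc 0 N, a (p ^ s)) * ∑ m ∈ Ioc 0 N, a m := by
  rw [Finset.sum_mul_sum, ← Finset.sum_product']
  refine sum_le_sum_of_injOn (fun m => (m.factorization p, m / p ^ m.factorization p)) ?_ ?_ ?_ ?_
  · intro m h
    simp only [mem_filter, mem_Ioc] at h
    obtain ⟨⟨h1, h2⟩, h3⟩ := h
    simp only [mem_product, mem_Ioc]
    refine ⟨⟨hp.factorization_pos_of_dvd h1.ne' h3, ?_⟩, Nat.ordCompl_pos p h1.ne', ?_⟩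
    · exact (Nat.factorization_lt p h1.ne').le.trans h2
    · exact (Nat.div_le_self _ _).trans h2
  · intro m _ n _ h
    obtain ⟨h1, h2⟩ := Prod.ext_iff.1 h
    simp only at h1 h2
    rw [← Nat.ordProj_mul_ordCompl_eq_self m p, ← Nat.ordProj_mul_ordCompl_eq_self n p, h2, h1]
  · intro y _
    exact mul_nonneg (hnn _) (hnn _)
  · intro m h
    simp only [mem_filter, mem_Ioc] at h
    have := hmul _ _ (Nat.Coprime.pow_left (m.factorization p) (Nat.coprime_ordCompl hp h.1.1.ne'))
    rw [Nat.ordProj_mul_ordCompl_eq_self] at this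
    exact this.le

theorem mul_log_le_rpow {C β ε : ℝ} (hC : 0 ≤ C) (hε : 0 < ε) {y : ℝ} {n : ℕ}
    (hy : y ≤ C * (n : ℝ) ^ (-β)) (hn : 1 ≤ n) :
    y * Real.log n ≤ C / ε * (n : ℝ) ^ (-(β - ε)) := by
  have hn0 : (0 : ℝ) < n := by exact_mod_cast hn
  calc y * Real.log n ≤ (C * (n : ℝ) ^ (-β)) * ((n : ℝ) ^ ε / ε) := by
        refine mul_le_mul hy (Real.log_le_rpow_div hn0.le hε) (Real.log_natCast_nonneg _)
          (by positivity)
    _ = C / ε * (n : ℝ) ^ (-(β - ε)) := by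
        rw [show -(β - ε) = -β + ε by ring, Real.rpow_add hn0]; ring

theorem exists_sum_proper_primePow_le {a : ℕ → ℝ} {C β : ℝ} (hC : 0 ≤ C)
    (hβ : 1 / 2 < β) (ha : ∀ n : ℕ, 1 ≤ n → a n ≤ C * (n : ℝ) ^ (-β)) :
    ∃ B : ℝ, 0 ≤ B ∧ ∀ K : ℕ,
      ∑ q ∈ Ioc 0 K with IsPrimePow q ∧ ¬ q.Prime, a q * Real.log q ≤ B := by
  have hε : 0 < (β - 1 / 2) / 2 := by linarith
  have hs := (summable_indicator_proper_primePow_rpow (β := β - (β - 1 / 2) / 2)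
    (by linarith)).mul_left (C / ((β - 1 / 2) / 2))
  have hnn : ∀ n : ℕ, 0 ≤ C / ((β - 1 / 2) / 2) * Set.indicator {n : ℕ | IsPrimePow n ∧ ¬ n.Prime}
      (fun n : ℕ => (n : ℝ) ^ (-(β - (β - 1 / 2) / 2))) n := fun n =>
    mul_nonneg (by positivity) (Set.indicator_nonneg (fun _ _ => by positivity) _)
  refine ⟨_, tsum_nonneg hnn, fun K => le_trans ?_ (hs.sum_le_tsum (Ioc 0 K) fun n _ => hnn n)⟩
  rw [Finset.sum_filter]
  refine Finset.sum_le_sum fun q hq => ?_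
  split_ifs with h
  · rw [Set.indicator_of_mem (show q ∈ {n : ℕ | IsPrimePow n ∧ ¬ n.Prime} from h)]
    exact mul_log_le_rpow hC hε (ha q (mem_Ioc.1 hq).1) (mem_Ioc.1 hq).1
  · exact hnn q

theorem rpow_prime_pow {p : ℕ} (β : ℝ) (s : ℕ) :
    (((p ^ s : ℕ) : ℝ)) ^ (-β) = ((p : ℝ) ^ (-β)) ^ s := by
  rw [Nat.cast_pow, ← Real.rpow_natCast, ← Real.rpow_mul (Nat.cast_nonneg _), mul_comm,
    Real.rpow_mul (Nat.cast_nonneg _), Real.rpow_natCast]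

theorem prime_rpow_neg_le {p : ℕ} (hp : p.Prime) {β : ℝ} (hβ : 0 < β) :
    (p : ℝ) ^ (-β) ≤ (2 : ℝ) ^ (-β) :=
  Real.rpow_le_rpow_of_nonpos (by norm_num) (by exact_mod_cast hp.two_le) (by linarith)

theorem two_rpow_neg_lt_one {β : ℝ} (hβ : 0 < β) : (2 : ℝ) ^ (-β) < 1 :=
  Real.rpow_lt_one_of_one_lt_of_neg (by norm_num) (by linarith)

theorem sum_prime_pow_le {a : ℕ → ℝ} {C β : ℝ} (hC : 0 ≤ C)
    (hβ : 0 < β) (ha : ∀ n : ℕ, 1 ≤ n → a n ≤ C * (n : ℝ) ^ (-β)) {p : ℕ} (hp : p.Prime)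
    (N : ℕ) : ∑ s ∈ Ioc 0 N, a (p ^ s) ≤ C / (1 - (2 : ℝ) ^ (-β)) * (p : ℝ) ^ (-β) := by
  have h2 := two_rpow_neg_lt_one hβ
  have hp2 := prime_rpow_neg_le hp hβ
  have hy0 : 0 ≤ (p : ℝ) ^ (-β) := by positivity
  set y := (p : ℝ) ^ (-β) with hy
  have hy1 : y < 1 := hp2.trans_lt h2
  have hsum := (summable_geometric_of_lt_one hy0 hy1).mul_left (C * y)
  calc ∑ s ∈ Ioc 0 N, a (p ^ s) ≤ ∑ s ∈ Ioc 0 N, C * y ^ s := by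
        refine Finset.sum_le_sum fun s _ => ?_
        have := ha (p ^ s) (Nat.one_le_pow _ _ hp.pos)
        rwa [rpow_prime_pow] at this
    _ = ∑ s ∈ range N, C * y * y ^ s := by
        rw [Finset.range_eq_Ico]
        refine (Finset.sum_nbij' (· + 1) (· - 1) ?_ ?_ ?_ ?_ ?_).symm
        · intro s hs; simp at hs ⊢; omega
        · intro s hs; simp at hs ⊢; omega
        · intro s _; simp
        · intro s hs; simp at hs ⊢; omega
        · intro s _; ring
    _ ≤ ∑' s, C * y * y ^ s := hsum.sum_le_tsum _ fun _ _ => by positivity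
    _ = C / (1 - y) * y := by
        rw [tsum_mul_left, tsum_geometric_of_lt_one hy0 hy1]; ring
    _ ≤ C / (1 - (2 : ℝ) ^ (-β)) * y := by
        have : 0 < 1 - (2 : ℝ) ^ (-β) := by linarith
        gcongr

theorem exists_sum_prime_mul_sum_prime_pow_le {a : ℕ → ℝ} {C β : ℝ} (hC : 0 ≤ C)
    (hβ : 1 / 2 < β) (hnn : ∀ n, 0 ≤ a n) (ha : ∀ n : ℕ, 1 ≤ n → a n ≤ C * (n : ℝ) ^ (-β)) :
    ∃ B : ℝ, 0 ≤ B ∧ ∀ N : ℕ,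
      ∑ p ∈ Ioc 0 N with p.Prime, a p * Real.log p * ∑ s ∈ Ioc 0 N, a (p ^ s) ≤ B := by
  set ε := (β - 1 / 2) / 2 with hεd
  have hε : 0 < ε := by rw [hεd]; linarith
  set E := C / (1 - (2 : ℝ) ^ (-β)) with hE
  have hE0 : 0 ≤ E := div_nonneg hC (by linarith [two_rpow_neg_lt_one (show 0 < β by linarith)])
  have hs : Summable fun n : ℕ => C / ε * E * (n : ℝ) ^ (-(2 * β - ε)) :=
    (Real.summable_nat_rpow.2 (by rw [hεd]; linarith)).mul_left _
  refine ⟨_, tsum_nonneg fun n => by positivity, fun N =>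
    le_trans ?_ (hs.sum_le_tsum (Ioc 0 N) fun n _ => by positivity)⟩
  rw [Finset.sum_filter]
  refine Finset.sum_le_sum fun p hp => ?_
  split_ifs with h
  · have h1 := mul_log_le_rpow hC hε (ha p h.one_lt.le) h.one_lt.le
    have h2 := sum_prime_pow_le hC (by linarith) ha h N
    calc _ ≤ (C / ε * (p : ℝ) ^ (-(β - ε))) * (E * (p : ℝ) ^ (-β)) :=
          mul_le_mul h1 h2 (Finset.sum_nonneg fun _ _ => hnn _) (by positivity)
      _ = _ := by
        rw [show -(2 * β - ε) = -(β - ε) + -β by ring,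
          Real.rpow_add (by exact_mod_cast h.pos)]
        ring
  · positivity

theorem exists_abs_sum_mul_log_sub_le {a : ℕ → ℝ} {C β κ D : ℝ} (hC : 0 ≤ C)
    (hβ : 1 / 2 < β) (hmul : ∀ m n : ℕ, Nat.Coprime m n → a (m * n) = a m * a n)
    (hnn : ∀ n, 0 ≤ a n) (ha : ∀ n : ℕ, 1 ≤ n → a n ≤ C * (n : ℝ) ^ (-β))
    (hD : ∀ w : ℝ, 1 ≤ w →
      |∑ p ∈ Ioc 0 ⌊w⌋₊ with p.Prime, a p * Real.log p - κ * Real.log w| ≤ D) :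
    ∃ A : ℝ, 1 ≤ A ∧ ∀ x : ℝ, 1 ≤ x →
      |∑ n ∈ Ioc 0 ⌊x⌋₊, a n * Real.log n -
        κ * ∑ n ∈ Ioc 0 ⌊x⌋₊, a n * (Real.log x - Real.log n)| ≤ A * ∑ n ∈ Ioc 0 ⌊x⌋₊, a n := by
  obtain ⟨B₁, hB₁, h₁⟩ := exists_sum_proper_primePow_le hC hβ ha
  obtain ⟨B₂, hB₂, h₂⟩ := exists_sum_prime_mul_sum_prime_pow_le hC hβ hnn ha
  have hD0 : 0 ≤ D := (abs_nonneg _).trans (hD 1 le_rfl)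
  refine ⟨1 + D + B₁ + B₂, by linarith, fun x hx => ?_⟩
  set N := ⌊x⌋₊ with hN
  have hM0 : 0 ≤ ∑ n ∈ Ioc 0 N, a n := Finset.sum_nonneg fun _ _ => hnn _
  have hal : ∀ n, 0 ≤ a n * Real.log n := fun n => mul_nonneg (hnn _) (Real.log_natCast_nonneg _)
  have hm : ∀ m ∈ Ioc 0 N, |∑ p ∈ Ioc 0 (N / m) with p.Prime, a p * Real.log p -
      κ * (Real.log x - Real.log m)| ≤ D := by
    intro m hm
    obtain ⟨hm1, hm2⟩ := mem_Ioc.1 hm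
    have hm0 : (0 : ℝ) < m := by exact_mod_cast hm1
    have hmx : (m : ℝ) ≤ x := (Nat.le_floor_iff (by linarith)).1 hm2
    have := hD (x / m) ((one_le_div hm0).2 hmx)
    rwa [Nat.floor_div_natCast, Real.log_div (by linarith) hm0.ne'] at this
  have hupper : ∑ n ∈ Ioc 0 N, a n * Real.log n ≤
      ∑ m ∈ Ioc 0 N, a m * (κ * (Real.log x - Real.log m) + D + B₁) := by
    calc _ ≤ ∑ n ∈ Ioc 0 N, ∑ y ∈ n.divisorsAntidiagonal,
          a y.1 * (if IsPrimePow y.2 then a y.2 * Real.log y.2 else 0) :=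
          Finset.sum_le_sum fun n hn =>
            mul_log_le_sum_divisorsAntidiagonal hmul hnn (mem_Ioc.1 hn).1.ne'
      _ = ∑ m ∈ Ioc 0 N, ∑ q ∈ Ioc 0 (N / m),
          a m * (if IsPrimePow q then a q * Real.log q else 0) :=
          sum_Ioc_sum_divisorsAntidiagonal
            (fun m q => a m * (if IsPrimePow q then a q * Real.log q else 0)) N
      _ ≤ _ := by
          refine Finset.sum_le_sum fun m hm' => ?_
          rw [← Finset.mul_sum]
          refine mul_le_mul_of_nonneg_left ?_ (hnn m)
          have e1 : ∑ q ∈ Ioc 0 (N / m), (if IsPrimePow q then a q * Real.log q else 0) =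
              ∑ p ∈ Ioc 0 (N / m) with p.Prime, a p * Real.log p +
              ∑ q ∈ Ioc 0 (N / m) with IsPrimePow q ∧ ¬ q.Prime, a q * Real.log q := by
            rw [Finset.sum_filter, Finset.sum_filter, ← Finset.sum_add_distrib]
            refine Finset.sum_congr rfl fun q _ => ?_
            by_cases hq : q.Prime
            · simp [hq, hq.isPrimePow]
            · simp [hq]
          rw [e1]
          linarith [(abs_le.1 (hm m hm')).2, h₁ (N / m)]
  have hlower : ∑ m ∈ Ioc 0 N, a m * (κ * (Real.log x - Real.log m) - D) -
      B₂ * ∑ n ∈ Ioc 0 N, a n ≤ ∑ n ∈ Ioc 0 N, a n * Real.log n := by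
    have e1 : ∑ m ∈ Ioc 0 N, ∑ p ∈ Ioc 0 (N / m),
        (if p.Prime ∧ ¬ p ∣ m then a m * (a p * Real.log p) else 0) ≤
        ∑ n ∈ Ioc 0 N, a n * Real.log n := by
      rw [← sum_Ioc_sum_divisorsAntidiagonal
        (fun m p => if p.Prime ∧ ¬ p ∣ m then a m * (a p * Real.log p) else 0) N]
      exact Finset.sum_le_sum fun n hn =>
        sum_divisorsAntidiagonal_le_mul_log hmul hnn (mem_Ioc.1 hn).1.ne'
    have e2 : ∑ m ∈ Ioc 0 N, ∑ p ∈ Ioc 0 N,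
        (if p.Prime ∧ p ∣ m then a m * (a p * Real.log p) else 0) ≤
        B₂ * ∑ n ∈ Ioc 0 N, a n := by
      rw [Finset.sum_comm]
      calc _ ≤ ∑ p ∈ Ioc 0 N with p.Prime,
            a p * Real.log p * (∑ s ∈ Ioc 0 N, a (p ^ s)) * ∑ m ∈ Ioc 0 N, a m := by
            rw [Finset.sum_filter]
            refine Finset.sum_le_sum fun p _ => ?_
            split_ifs with hp
            · rw [mul_assoc]
              refine le_trans (le_of_eq ?_)
                (mul_le_mul_of_nonneg_left (sum_filter_dvd_le hmul hnn hp N) (hal p))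
              rw [Finset.mul_sum, Finset.sum_filter]
              refine Finset.sum_congr rfl fun m _ => ?_
              simp only [hp, true_and, mul_comm]
            · simp [hp]
        _ ≤ _ := by
            rw [← Finset.sum_mul]
            exact mul_le_mul_of_nonneg_right (h₂ N) hM0
    have e3 : ∑ m ∈ Ioc 0 N, a m * (κ * (Real.log x - Real.log m) - D) ≤
        ∑ m ∈ Ioc 0 N, (∑ p ∈ Ioc 0 (N / m),
          (if p.Prime ∧ ¬ p ∣ m then a m * (a p * Real.log p) else 0) + ∑ p ∈ Ioc 0 N,
          (if p.Prime ∧ p ∣ m then a m * (a p * Real.log p) else 0)) := by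
      refine Finset.sum_le_sum fun m hm' => ?_
      calc _ ≤ a m * ∑ p ∈ Ioc 0 (N / m) with p.Prime, a p * Real.log p :=
            mul_le_mul_of_nonneg_left (by linarith [(abs_le.1 (hm m hm')).1]) (hnn m)
        _ = ∑ p ∈ Ioc 0 (N / m),
            (if p.Prime ∧ ¬ p ∣ m then a m * (a p * Real.log p) else 0) +
            ∑ p ∈ Ioc 0 (N / m), (if p.Prime ∧ p ∣ m then a m * (a p * Real.log p) else 0) := by
            rw [← Finset.sum_add_distrib, Finset.mul_sum, Finset.sum_filter]
            refine Finset.sum_congr rfl fun p _ => ?_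
            by_cases h1 : p.Prime <;> by_cases h2 : p ∣ m <;> simp [h1, h2]
        _ ≤ _ := by
            refine add_le_add le_rfl (Finset.sum_le_sum_of_subset_of_nonneg
              (Finset.Ioc_subset_Ioc le_rfl (Nat.div_le_self _ _)) fun p _ _ => ?_)
            split_ifs
            · exact mul_nonneg (hnn _) (hal _)
            · exact le_rfl
    rw [Finset.sum_add_distrib] at e3
    linarith
  have r1 : ∑ m ∈ Ioc 0 N, a m * (κ * (Real.log x - Real.log m) + D + B₁) =
      κ * ∑ n ∈ Ioc 0 N, a n * (Real.log x - Real.log n) + (D + B₁) * ∑ n ∈ Ioc 0 N, a n := by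
    rw [Finset.mul_sum, Finset.mul_sum, ← Finset.sum_add_distrib]
    exact Finset.sum_congr rfl fun _ _ => by ring
  have r2 : ∑ m ∈ Ioc 0 N, a m * (κ * (Real.log x - Real.log m) - D) =
      κ * ∑ n ∈ Ioc 0 N, a n * (Real.log x - Real.log n) - D * ∑ n ∈ Ioc 0 N, a n := by
    rw [Finset.mul_sum, Finset.mul_sum, ← Finset.sum_sub_distrib]
    exact Finset.sum_congr rfl fun _ _ => by ring
  rw [r1] at hupper
  rw [r2] at hlower
  have := mul_nonneg hB₁ hM0
  have := mul_nonneg hB₂ hM0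
  have := mul_nonneg hD0 hM0
  rw [abs_le]
  constructor <;> nlinarith

theorem hasDerivWithinAt_mul_rpow_neg {T : ℝ → ℝ} {m k u : ℝ} (hu : 0 < u)
    (hT : HasDerivWithinAt T m (Set.Ici u) u) :
    HasDerivWithinAt (fun t => T t * t ^ (-k)) ((m - k * T u / u) * u ^ (-k)) (Set.Ici u) u := by
  have := hT.mul ((Real.hasDerivAt_rpow_const (p := -k) (Or.inl hu.ne')).hasDerivWithinAt)
  convert! this using 1
  rw [Real.rpow_sub_one hu.ne']
  ring

theorem hasDerivAt_const_div {K u : ℝ} (hu : 0 < u) :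
    HasDerivAt (fun t => K / t) (-K / u ^ 2) u := by
  have := (hasDerivAt_inv hu.ne').const_mul K
  convert! this using 1
  ring

/-- If the right derivative of `G` is at most `K * G / u ^ 2` in absolute value, then `G` converges
at rate `O(1 / u)`. -/
theorem exists_abs_sub_le_div_of_abs_deriv_le {G G' : ℝ → ℝ} {K u₀ : ℝ} (hu₀ : 0 < u₀) (hK : 0 ≤ K)
    (hG : ContinuousOn G (Set.Ici u₀)) (hG0 : ∀ u, u₀ ≤ u → 0 ≤ G u)
    (hG' : ∀ u, u₀ ≤ u → HasDerivWithinAt G (G' u) (Set.Ici u) u)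
    (hle : ∀ u, u₀ ≤ u → |G' u| ≤ K * G u / u ^ 2) :
    ∃ l B : ℝ, 0 ≤ B ∧ ∀ u, u₀ ≤ u → G u ≤ B ∧ |G u - l| ≤ K * B / u := by
  set B := G u₀ * Real.exp (K / u₀) with hB
  have hB0 : 0 ≤ B := mul_nonneg (hG0 _ le_rfl) (Real.exp_pos _).le
  have hcont : ∀ {K : ℝ}, ContinuousOn (fun u : ℝ => K / u) (Set.Ici u₀) := fun u hu =>
    (hasDerivAt_const_div (hu₀.trans_le hu)).continuousAt.continuousWithinAt
  have hbound : ∀ u, u₀ ≤ u → G u ≤ B := by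
    intro u hu
    have h := image_le_of_deriv_right_le_deriv_boundary
      (f := fun t => G t * Real.exp (K / t))
      (f' := fun t => G' t * Real.exp (K / t) + G t * (Real.exp (K / t) * (-K / t ^ 2)))
      (a := u₀) (b := u) (B := fun _ => B) (B' := fun _ => 0)
      ((hG.mul (hcont.rexp)).mono Set.Icc_subset_Ici_self)
      (fun t ht => (hG' t ht.1).mul
        ((hasDerivAt_const_div (hu₀.trans_le ht.1)).exp.hasDerivWithinAt))
      le_rfl continuousOn_const (fun t _ => hasDerivWithinAt_const _ _ _)
      (fun t ht => by
        have h1 := (le_abs_self _).trans (hle t ht.1)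
        have : G' t * Real.exp (K / t) + G t * (Real.exp (K / t) * (-K / t ^ 2)) =
          (G' t - K * G t / t ^ 2) * Real.exp (K / t) := by ring
        rw [this]
        exact mul_nonpos_of_nonpos_of_nonneg (by linarith) (Real.exp_pos _).le)
      (Set.right_mem_Icc.2 hu)
    refine le_trans ?_ h
    exact le_mul_of_one_le_right (hG0 u hu)
      (Real.one_le_exp (div_nonneg hK (hu₀.le.trans hu)))
  have hdiff : ∀ s t, u₀ ≤ s → s ≤ t → |G t - G s| ≤ K * B / s := by
    intro s t hs hst
    have hs0 := hu₀.trans_le hs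
    have h := image_norm_le_of_norm_deriv_right_le_deriv_boundary'
      (f := fun t => G t - G s) (f' := G') (a := s) (b := t)
      (B := fun t => K * B / s - K * B / t) (B' := fun t => K * B / t ^ 2)
      ((hG.sub continuousOn_const).mono (Set.Icc_subset_Ici_self.trans (Set.Ici_subset_Ici.2 hs)))
      (fun u hu => (hG' u (hs.trans hu.1)).sub_const _) (by simp)
      ((continuousOn_const.sub hcont).mono
        (Set.Icc_subset_Ici_self.trans (Set.Ici_subset_Ici.2 hs)))
      (fun u hu => by
        have := ((hasDerivAt_const_div (K := K * B) (hs0.trans_le hu.1)).const_sub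
          (K * B / s)).hasDerivWithinAt (s := Set.Ici u)
        convert! this using 1
        ring)
      (fun u hu => by
        refine (hle u (hs.trans hu.1)).trans ?_
        have := hbound u (hs.trans hu.1)
        gcongr)
      (Set.right_mem_Icc.2 hst)
    refine h.trans ?_
    have : 0 ≤ K * B / t := div_nonneg (mul_nonneg hK hB0) (hs0.le.trans hst)
    linarith
  have hlim : Tendsto (fun n : ℕ => K * B / (u₀ + n)) atTop (nhds 0) :=
    tendsto_const_nhds.div_atTop (tendsto_atTop_add_const_left _ _ tendsto_natCast_atTop_atTop)
  have hcau : CauchySeq fun n : ℕ => G (u₀ + n) := by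
    refine cauchySeq_of_le_tendsto_0' _ (fun n k hnk => ?_) hlim
    rw [dist_comm, Real.dist_eq]
    exact hdiff _ _ (by simp) (by gcongr)
  obtain ⟨l, hl⟩ := cauchySeq_tendsto_of_complete hcau
  refine ⟨l, B, hB0, fun u hu => ⟨hbound u hu, ?_⟩⟩
  rw [abs_sub_comm]
  refine le_of_tendsto ((hl.sub_const _).abs) ?_
  filter_upwards [eventually_ge_atTop ⌈u⌉₊] with n hn
  exact hdiff u _ hu (by linarith [Nat.ceil_le.1 hn])

theorem exists_abs_sub_const_mul_rpow_le {T m : ℝ → ℝ} {κ A u₁ : ℝ} (hκ : 0 ≤ κ) (hA : 1 ≤ A)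
    (hu₁ : 0 < u₁)
    (hT : Continuous T) (hm0 : ∀ u, 0 ≤ m u) (hmono : Monotone m)
    (hderiv : ∀ u, HasDerivWithinAt T (m u) (Set.Ici u) u)
    (hΔ : ∀ u, 0 ≤ u → |u * m u - (κ + 1) * T u| ≤ A * m u) :
    ∃ c K : ℝ, ∀ u, u₁ ≤ u → |m u - c * u ^ κ| ≤ K * u ^ (κ - 1) := by
  set u₀ := 2 * A with hu₀d
  have hu₀ : 0 < u₀ := by linarith
  have hmT : ∀ u, u₀ ≤ u → u * m u ≤ 2 * (κ + 1) * T u := by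
    intro u hu
    have h1 := (abs_le.1 (hΔ u (by linarith))).2
    have h2 : 2 * A * m u ≤ u * m u := mul_le_mul_of_nonneg_right hu (hm0 u)
    linarith
  have hT0 : ∀ u, u₀ ≤ u → 0 ≤ T u := by
    intro u hu
    have h1 := hmT u hu
    have h2 : 0 ≤ u * m u := mul_nonneg (by linarith) (hm0 u)
    by_contra! h
    nlinarith
  obtain ⟨l, B, hB0, hl⟩ := exists_abs_sub_le_div_of_abs_deriv_le
    (G := fun u => T u * u ^ (-(κ + 1))) (G' := fun u => (m u - (κ + 1) * T u / u) * u ^ (-(κ + 1)))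
    (K := 2 * A * (κ + 1)) hu₀ (by positivity)
    (hT.continuousOn.mul fun u hu => (Real.continuousAt_rpow_const _ _
      (Or.inl (hu₀.trans_le hu).ne')).continuousWithinAt)
    (fun u hu => mul_nonneg (hT0 u hu) (Real.rpow_nonneg (hu₀.le.trans hu) _))
    (fun u hu => hasDerivWithinAt_mul_rpow_neg (hu₀.trans_le hu) (hderiv u))
    (fun u hu => by
      have hu0 : 0 < u := hu₀.trans_le hu
      have hP : 0 < u ^ (-(κ + 1)) := Real.rpow_pos_of_pos hu0 _
      rw [abs_mul, abs_of_pos hP]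
      have e : m u - (κ + 1) * T u / u = (u * m u - (κ + 1) * T u) / u := by field_simp
      rw [e, abs_div, abs_of_pos hu0]
      have h1 : |u * m u - (κ + 1) * T u| ≤ 2 * A * (κ + 1) * T u / u := by
        refine (hΔ u hu0.le).trans ?_
        rw [le_div_iff₀ hu0]
        nlinarith [hmT u hu]
      calc _ ≤ 2 * A * (κ + 1) * T u / u / u * u ^ (-(κ + 1)) := by gcongr
        _ = _ := by field_simp)
  have hlarge : ∀ u, u₀ ≤ u → |m u - (κ + 1) * l * u ^ κ| ≤
      ((κ + 1) * (2 * A * (κ + 1) * B) + 2 * A * (κ + 1) * B) * u ^ (κ - 1) := by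
    intro u hu
    have hu0 : 0 < u := hu₀.trans_le hu
    obtain ⟨h1, h2⟩ := hl u hu
    have hP : 0 < u ^ κ := Real.rpow_pos_of_pos hu0 _
    simp only [Real.rpow_neg hu0.le, Real.rpow_add_one hu0.ne'] at h1 h2
    rw [Real.rpow_sub_one hu0.ne']
    have hT1 : T u ≤ B * (u ^ κ * u) := by
      rwa [← div_eq_mul_inv, div_le_iff₀ (by positivity)] at h1
    have hT2 : |T u - l * (u ^ κ * u)| ≤ 2 * A * (κ + 1) * B * u ^ κ := by
      have e : T u - l * (u ^ κ * u) = (T u * (u ^ κ * u)⁻¹ - l) * (u ^ κ * u) := by field_simp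
      rw [e, abs_mul, abs_of_pos (show 0 < u ^ κ * u by positivity)]
      calc _ ≤ 2 * A * (κ + 1) * B / u * (u ^ κ * u) := by gcongr
        _ = _ := by field_simp
    have h3 : A * m u ≤ 2 * A * (κ + 1) * B * u ^ κ := by
      have h5 := (hmT u hu).trans (mul_le_mul_of_nonneg_left hT1 (by positivity))
      have h6 : m u ≤ 2 * (κ + 1) * (B * u ^ κ) := by
        have : u * m u ≤ u * (2 * (κ + 1) * (B * u ^ κ)) := by linarith
        exact le_of_mul_le_mul_left this hu0
      have := mul_le_mul_of_nonneg_left h6 (show 0 ≤ A by linarith)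
      linarith
    have h4 := hΔ u hu0.le
    have e : m u - (κ + 1) * l * u ^ κ =
      ((u * m u - (κ + 1) * T u) + (κ + 1) * (T u - l * (u ^ κ * u))) / u := by
      field_simp; ring
    rw [e, abs_div, abs_of_pos hu0, ← mul_div_assoc]
    refine div_le_div_of_nonneg_right ((abs_add_le _ _).trans ?_) hu0.le
    rw [abs_mul, abs_of_nonneg (show 0 ≤ κ + 1 by linarith)]
    have := mul_le_mul_of_nonneg_left hT2 (show 0 ≤ κ + 1 by linarith)
    linarith
  set K₁ := (κ + 1) * (2 * A * (κ + 1) * B) + 2 * A * (κ + 1) * B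
  set K₂ := (m u₀ + |(κ + 1) * l| * u₀ ^ κ) * (u₀ / u₁ ^ κ)
  have hK₁ : 0 ≤ K₁ := by positivity
  have hK₂ : 0 ≤ K₂ := by have := hm0 u₀; positivity
  refine ⟨(κ + 1) * l, K₁ + K₂, fun u hu => ?_⟩
  have hu0 : 0 < u := hu₁.trans_le hu
  have hQ : 0 < u ^ (κ - 1) := Real.rpow_pos_of_pos hu0 _
  rcases le_total u₀ u with h | h
  · refine (hlarge u h).trans ?_
    nlinarith
  · have h1 : |m u - (κ + 1) * l * u ^ κ| ≤ m u₀ + |(κ + 1) * l| * u₀ ^ κ := by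
      refine (abs_sub _ _).trans ?_
      rw [abs_of_nonneg (hm0 u), abs_mul, abs_of_nonneg (show 0 ≤ u ^ κ by positivity)]
      gcongr
      exact hmono h
    have h2 : 1 ≤ u₀ / u₁ ^ κ * u ^ (κ - 1) := by
      rw [Real.rpow_sub_one hu0.ne', div_mul_div_comm, one_le_div (by positivity), mul_comm u₀]
      gcongr
    have h3 : m u₀ + |(κ + 1) * l| * u₀ ^ κ ≤ K₂ * u ^ (κ - 1) := by
      have := hm0 u₀
      rw [mul_assoc]
      exact le_mul_of_one_le_right (by positivity) h2
    nlinarith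

/-- The sum of `f n` over `n ≤ exp u`. -/
noncomputable def expSum (f : ℕ → ℝ) (u : ℝ) : ℝ := ∑ n ∈ Ioc 0 ⌊Real.exp u⌋₊, f n

/-- The integral of `expSum f` up to `u`. -/
noncomputable def expSumIntegral (f : ℕ → ℝ) (u : ℝ) : ℝ :=
  ∑ n ∈ Ioc 0 ⌊Real.exp u⌋₊, f n * (u - Real.log n)

theorem floor_exp_mono : Monotone fun u : ℝ => ⌊Real.exp u⌋₊ := fun _ _ h =>
  Nat.floor_mono (Real.exp_le_exp.2 h)

theorem le_floor_exp_iff {n : ℕ} (hn : 0 < n) {u : ℝ} : n ≤ ⌊Real.exp u⌋₊ ↔ Real.log n ≤ u := by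
  rw [Nat.le_floor_iff (Real.exp_pos u).le, Real.log_le_iff_le_exp (by exact_mod_cast hn)]

theorem expSum_mono {f : ℕ → ℝ} (hf : ∀ n, 0 ≤ f n) : Monotone (expSum f) := fun _ _ h =>
  Finset.sum_le_sum_of_subset_of_nonneg (Finset.Ioc_subset_Ioc le_rfl (floor_exp_mono h))
    fun _ _ _ => hf _

theorem continuous_expSumIntegral (f : ℕ → ℝ) : Continuous (expSumIntegral f) := by
  rw [continuous_iff_continuousAt]
  intro u
  have hc : Continuous fun v : ℝ =>
      ∑ n ∈ Ioc 0 ⌊Real.exp (u + 1)⌋₊, f n * max (v - Real.log n) 0 := by fun_prop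
  refine hc.continuousAt.congr ?_
  filter_upwards [eventually_lt_nhds (show u < u + 1 by linarith)] with v hv
  symm
  rw [expSumIntegral]
  have hsub : Ioc 0 ⌊Real.exp v⌋₊ ⊆ Ioc 0 ⌊Real.exp (u + 1)⌋₊ :=
    Finset.Ioc_subset_Ioc le_rfl (floor_exp_mono hv.le)
  rw [← Finset.sum_subset hsub]
  · refine Finset.sum_congr rfl fun n hn => ?_
    obtain ⟨h1, h2⟩ := mem_Ioc.1 hn
    rw [max_eq_left (by linarith [(le_floor_exp_iff h1).1 h2])]
  · intro n hn hn'
    obtain ⟨h1, h2⟩ := mem_Ioc.1 hn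
    have : ¬ Real.log n ≤ v := fun h => hn' (mem_Ioc.2 ⟨h1, (le_floor_exp_iff h1).2 h⟩)
    rw [max_eq_right (by linarith), mul_zero]

theorem hasDerivWithinAt_expSumIntegral (f : ℕ → ℝ) (u : ℝ) :
    HasDerivWithinAt (expSumIntegral f) (expSum f u) (Set.Ici u) u := by
  have h : HasDerivWithinAt (fun v => ∑ n ∈ Ioc 0 ⌊Real.exp u⌋₊, f n * (v - Real.log n))
      (expSum f u) (Set.Ici u) u := by
    have := HasDerivAt.fun_sum (u := Ioc 0 ⌊Real.exp u⌋₊)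
      (A := fun n v => f n * (v - Real.log n)) (A' := fun n => f n * 1) (x := u)
      fun n _ => ((hasDerivAt_id u).sub_const _).const_mul _
    simp only [mul_one] at this
    exact this.hasDerivWithinAt
  refine h.congr_of_eventuallyEq ?_ rfl
  have hlt : ∀ᶠ v in nhds u, Real.exp v < ⌊Real.exp u⌋₊ + 1 :=
    Real.continuous_exp.continuousAt.eventually_lt continuousAt_const (Nat.lt_floor_add_one _)
  filter_upwards [mem_nhdsWithin_of_mem_nhds hlt, self_mem_nhdsWithin] with v hv huv
  have : ⌊Real.exp v⌋₊ = ⌊Real.exp u⌋₊ := by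
    refine le_antisymm ?_ (floor_exp_mono huv)
    rw [← Nat.lt_add_one_iff, Nat.floor_lt (Real.exp_pos v).le]
    exact_mod_cast hv
  simp only [expSumIntegral, this]

theorem exists_abs_expSum_sub_le {a : ℕ → ℝ} {C β κ D : ℝ} (hκ : 0 ≤ κ) (hC : 0 ≤ C)
    (hβ : 1 / 2 < β) (hmul : ∀ m n : ℕ, Nat.Coprime m n → a (m * n) = a m * a n)
    (hnn : ∀ n, 0 ≤ a n) (ha : ∀ n : ℕ, 1 ≤ n → a n ≤ C * (n : ℝ) ^ (-β))
    (hD : ∀ w : ℝ, 1 ≤ w →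
      |∑ p ∈ Ioc 0 ⌊w⌋₊ with p.Prime, a p * Real.log p - κ * Real.log w| ≤ D) :
    ∃ c K : ℝ, ∀ u, Real.log 2 ≤ u → |expSum a u - c * u ^ κ| ≤ K * u ^ (κ - 1) := by
  obtain ⟨A, hA, h⟩ := exists_abs_sum_mul_log_sub_le hC hβ hmul hnn ha hD
  refine exists_abs_sub_const_mul_rpow_le (T := expSumIntegral a) hκ hA (Real.log_pos (by norm_num))
    (continuous_expSumIntegral a) (fun u => Finset.sum_nonneg fun _ _ => hnn _) (expSum_mono hnn)
    (hasDerivWithinAt_expSumIntegral a) fun u hu => ?_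
  have := h (Real.exp u) (Real.one_le_exp hu)
  rw [Real.log_exp] at this
  convert! this using 2
  have e : ∑ n ∈ Ioc 0 ⌊Real.exp u⌋₊, a n * Real.log n = u * expSum a u - expSumIntegral a u := by
    rw [expSum, expSumIntegral, Finset.mul_sum, ← Finset.sum_sub_distrib]
    exact Finset.sum_congr rfl fun _ _ => by ring
  rw [e, expSumIntegral]
  ring

open MeasureTheory in
theorem tsum_mul_rpow_neg_eq_integral {f : ℕ → ℝ} (hf0 : f 0 = 0) {s : ℝ} (hs : 0 < s)
    (hsum : Summable fun n : ℕ => |f n| * (n : ℝ) ^ (-s)) :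
    ∑' n : ℕ, f n * (n : ℝ) ^ (-s) = ∫ v in Set.Ioi 0, expSum f (v / s) * Real.exp (-v) := by
  have hlog : ∀ n : ℕ, 0 ≤ s * Real.log n := fun n => mul_nonneg hs.le (Real.log_natCast_nonneg n)
  set F : ℕ → ℝ → ℝ := fun n => (Set.Ici (s * Real.log n)).indicator fun v => f n * Real.exp (-v)
    with hF
  have hint : ∀ (y t : ℝ), 0 ≤ t →
      ∫ v in Set.Ioi 0, (Set.Ici t).indicator (fun v => y * Real.exp (-v)) v =
        y * Real.exp (-t) := by
    intro y t ht
    rw [setIntegral_indicator measurableSet_Ici]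
    have : (Set.Ioi (0 : ℝ) ∩ Set.Ici t : Set ℝ) =ᵐ[volume] Set.Ioi t := by
      refine (ae_eq_set_inter (ae_eq_refl _) Ioi_ae_eq_Ici.symm).trans ?_
      rw [Set.Ioi_inter_Ioi, max_eq_right ht]
      exact ae_eq_refl _
    rw [setIntegral_congr_set this, integral_const_mul, integral_exp_neg_Ioi]
  have hexp : ∀ n : ℕ, n ≠ 0 → Real.exp (-(s * Real.log n)) = (n : ℝ) ^ (-s) := by
    intro n hn
    rw [Real.rpow_def_of_pos (by exact_mod_cast Nat.pos_of_ne_zero hn)]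
    congr 1; ring
  have hFi : ∀ n, Integrable (F n) (volume.restrict (Set.Ioi 0)) := fun n =>
    (((integrableOn_exp_neg_Ioi 0).integrable).const_mul _).indicator measurableSet_Ici
  have hnorm : ∀ n, ∫ v in Set.Ioi 0, ‖F n v‖ = |f n| * (n : ℝ) ^ (-s) := by
    intro n
    rcases eq_or_ne n 0 with rfl | hn
    · simp [hF, hf0]
    rw [← hexp n hn, ← hint _ _ (hlog n)]
    refine integral_congr_ae (Eventually.of_forall fun v => ?_)
    simp only [hF, norm_indicator_eq_indicator_norm, norm_mul, Real.norm_eq_abs, Real.abs_exp]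
  have key := hasSum_integral_of_summable_integral_norm hFi (by simpa only [hnorm] using hsum)
  calc ∑' n : ℕ, f n * (n : ℝ) ^ (-s) = ∑' n, ∫ v in Set.Ioi 0, F n v := by
        refine tsum_congr fun n => ?_
        rcases eq_or_ne n 0 with rfl | hn
        · simp [hF, hf0]
        · rw [← hexp n hn, ← hint _ _ (hlog n)]
    _ = ∫ v in Set.Ioi 0, ∑' n, F n v := key.tsum_eq
    _ = _ := by
        refine integral_congr_ae (Eventually.of_forall fun v => ?_)
        simp only
        rw [tsum_eq_sum (s := Ioc 0 ⌊Real.exp (v / s)⌋₊), expSum, Finset.sum_mul]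
        · refine Finset.sum_congr rfl fun n hn => ?_
          obtain ⟨h1, h2⟩ := mem_Ioc.1 hn
          rw [le_floor_exp_iff h1, le_div_iff₀' hs] at h2
          exact Set.indicator_of_mem (Set.mem_Ici.2 h2) _
        · intro n hn
          rcases Nat.eq_zero_or_pos n with rfl | h1
          · simp [hF, hf0]
          · refine Set.indicator_of_notMem (fun h => hn (mem_Ioc.2 ⟨h1, ?_⟩)) _
            rw [le_floor_exp_iff h1, le_div_iff₀' hs]
            exact h

theorem exists_abs_expSum_le {f : ℕ → ℝ} {κ c : ℝ}
    (hlim : Tendsto (fun u => expSum f u / u ^ κ) atTop (nhds c)) :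
    ∃ A : ℝ, ∀ u, 0 ≤ u → |expSum f u| ≤ A * (1 + u ^ κ) := by
  have h1 := hlim.abs.eventually_lt_const (lt_add_one |c|)
  obtain ⟨U, hU⟩ := eventually_atTop.1 h1
  set Q := ∑ n ∈ Ioc 0 ⌊Real.exp (max U 1)⌋₊, |f n|
  have hQ : 0 ≤ Q := Finset.sum_nonneg fun _ _ => abs_nonneg _
  have hc : 0 ≤ |c| := abs_nonneg c
  refine ⟨|c| + 1 + Q, fun u hu => ?_⟩
  have hp : 0 ≤ u ^ κ := Real.rpow_nonneg hu _
  rcases le_total (max U 1) u with h | h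
  · have hu0 : 0 < u := lt_of_lt_of_le zero_lt_one ((le_max_right _ _).trans h)
    have hp' : 0 < u ^ κ := Real.rpow_pos_of_pos hu0 _
    have := hU u ((le_max_left _ _).trans h)
    rw [abs_div, abs_of_pos hp', div_lt_iff₀ hp'] at this
    nlinarith
  · have : |expSum f u| ≤ Q := (Finset.abs_sum_le_sum_abs _ _).trans
      (Finset.sum_le_sum_of_subset_of_nonneg (Finset.Ioc_subset_Ioc le_rfl (floor_exp_mono h))
        fun _ _ _ => abs_nonneg _)
    nlinarith [mul_nonneg hc hp, mul_nonneg hQ hp]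

open MeasureTheory in
/-- An Abelian theorem for Dirichlet series at the edge of convergence. -/
theorem tendsto_rpow_mul_tsum_mul_rpow_neg {f : ℕ → ℝ} {κ c : ℝ} (hκ : 0 ≤ κ) (hf0 : f 0 = 0)
    (hsum : ∀ s : ℝ, 0 < s → Summable fun n : ℕ => |f n| * (n : ℝ) ^ (-s))
    (hlim : Tendsto (fun u => expSum f u / u ^ κ) atTop (nhds c)) :
    Tendsto (fun s : ℝ => s ^ κ * ∑' n : ℕ, f n * (n : ℝ) ^ (-s)) (nhdsWithin 0 (Set.Ioi 0))
      (nhds (c * Real.Gamma (κ + 1))) := by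
  obtain ⟨A, hA⟩ := exists_abs_expSum_le hlim
  have hA0 : 0 ≤ A := by
    have h1 := (abs_nonneg _).trans (hA 0 le_rfl)
    have h2 : (0 : ℝ) ≤ 0 ^ κ := Real.rpow_nonneg le_rfl _
    by_contra! h
    nlinarith
  have hmeas : Measurable (expSum f) :=
    (Measurable.of_discrete (f := fun N : ℕ => ∑ n ∈ Ioc 0 N, f n)).comp
      (Nat.measurable_floor.comp Real.measurable_exp)
  have hG : Integrable (fun v : ℝ => Real.exp (-v) * v ^ κ) (volume.restrict (Set.Ioi 0)) := by
    have := Real.GammaIntegral_convergent (s := κ + 1) (by linarith)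
    simpa only [add_sub_cancel_right] using this.integrable
  have hmain : Tendsto (fun s : ℝ => ∫ v in Set.Ioi 0, s ^ κ * (expSum f (v / s) * Real.exp (-v)))
      (nhdsWithin 0 (Set.Ioi 0)) (nhds (∫ v in Set.Ioi 0, c * (Real.exp (-v) * v ^ κ))) := by
    refine tendsto_integral_filter_of_dominated_convergence
      (fun v => A * (Real.exp (-v) + Real.exp (-v) * v ^ κ)) ?_ ?_ ?_ ?_
    · refine Eventually.of_forall fun s => Measurable.aestronglyMeasurable ?_
      have : Measurable fun v : ℝ => expSum f (v / s) := hmeas.comp (measurable_id.div_const s)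
      fun_prop
    · filter_upwards [Ioo_mem_nhdsGT (zero_lt_one' ℝ)] with s hs
      filter_upwards [ae_restrict_mem measurableSet_Ioi] with v hv
      have hv : 0 < v := hv
      have hs1 : s ^ κ ≤ 1 := Real.rpow_le_one hs.1.le hs.2.le hκ
      have hs0 : 0 < s ^ κ := Real.rpow_pos_of_pos hs.1 _
      have h1 := hA (v / s) (div_nonneg hv.le hs.1.le)
      rw [Real.div_rpow hv.le hs.1.le] at h1
      rw [norm_mul, norm_mul, Real.norm_eq_abs, Real.norm_eq_abs, Real.norm_eq_abs, Real.abs_exp,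
        abs_of_pos hs0]
      have hE := Real.exp_pos (-v)
      calc s ^ κ * (|expSum f (v / s)| * Real.exp (-v))
          ≤ s ^ κ * (A * (1 + v ^ κ / s ^ κ) * Real.exp (-v)) := by gcongr
        _ = A * (s ^ κ * Real.exp (-v) + Real.exp (-v) * v ^ κ) := by field_simp
        _ ≤ _ := by gcongr; exact mul_le_of_le_one_left hE.le hs1
    · exact (((integrableOn_exp_neg_Ioi 0).integrable).add hG).const_mul A
    · filter_upwards [ae_restrict_mem measurableSet_Ioi] with v hv
      have hv : 0 < v := hv
      have h1 : Tendsto (fun s : ℝ => v / s) (nhdsWithin 0 (Set.Ioi 0)) atTop :=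
        tendsto_inv_nhdsGT_zero.const_mul_atTop hv
      have h2 := (hlim.comp h1).mul_const (v ^ κ * Real.exp (-v))
      have e : c * (Real.exp (-v) * v ^ κ) = c * (v ^ κ * Real.exp (-v)) := by ring
      rw [e]
      refine h2.congr' ?_
      filter_upwards [self_mem_nhdsWithin] with s hs
      have hs : 0 < s := hs
      have hs0 : 0 < s ^ κ := Real.rpow_pos_of_pos hs _
      have hv0 : 0 < v ^ κ := Real.rpow_pos_of_pos hv _
      simp only [Function.comp]
      rw [Real.div_rpow hv.le hs.le]
      field_simp
  rw [integral_const_mul, show ∫ v in Set.Ioi (0 : ℝ), Real.exp (-v) * v ^ κ =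
    Real.Gamma (κ + 1) by rw [Real.Gamma_eq_integral (by linarith)]; simp] at hmain
  refine hmain.congr' ?_
  filter_upwards [self_mem_nhdsWithin] with s hs
  rw [tsum_mul_rpow_neg_eq_integral hf0 hs (hsum s hs), integral_const_mul]

theorem summable_mul_rpow_neg_of_tendsto {a : ℕ → ℝ} {κ c : ℝ} (hnn : ∀ n, 0 ≤ a n)
    (hlim : Tendsto (fun u => expSum a u / u ^ κ) atTop (nhds c)) {s : ℝ} (hs : 0 < s) :
    Summable fun n : ℕ => a n * (n : ℝ) ^ (-s) := by
  have hO : (fun n : ℕ => ∑ k ∈ Icc 1 n, a k) =O[atTop] fun n : ℕ => (n : ℝ) ^ (s / 2) := by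
    have hlog : Tendsto (fun n : ℕ => Real.log n) atTop atTop :=
      Real.tendsto_log_atTop.comp tendsto_natCast_atTop_atTop
    have h1 := (hlim.comp hlog).isBigO_one ℝ
    have h2 : (fun n : ℕ => Real.log n ^ κ) =O[atTop] fun n : ℕ => (n : ℝ) ^ (s / 2) :=
      ((isLittleO_log_rpow_rpow_atTop κ (half_pos hs)).isBigO).comp_tendsto
        tendsto_natCast_atTop_atTop
    have h3 := h1.mul h2
    simp only [one_mul] at h3
    refine h3.congr' ?_ EventuallyEq.rfl
    filter_upwards [eventually_gt_atTop 1] with n hn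
    have hn1 : (1 : ℝ) < n := by exact_mod_cast hn
    have hl : 0 < Real.log n := Real.log_pos hn1
    simp only [Function.comp]
    rw [div_mul_cancel₀ _ (Real.rpow_pos_of_pos hl _).ne', expSum,
      Real.exp_log (by linarith), Nat.floor_natCast]
    rfl
  have h := LSeriesSummable_of_sum_norm_bigO_and_nonneg hO hnn (s := (s : ℂ)) (half_pos hs).le
    (by simpa using half_lt_self hs)
  have h2 := h.norm
  simp only [LSeries.norm_term_eq, Complex.ofReal_re] at h2
  refine h2.congr fun n => ?_
  split_ifs with hn
  · subst hn; simp [Real.zero_rpow (neg_ne_zero.2 hs.ne')]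
  · rw [Complex.norm_real, Real.norm_of_nonneg (hnn n), Real.rpow_neg (Nat.cast_nonneg _),
      div_eq_mul_inv]

theorem sum_Ioc_log_eq_log_factorial (N : ℕ) :
    ∑ n ∈ Ioc 0 N, Real.log n = Real.log (N.factorial : ℝ) := by
  induction N with
  | zero => simp
  | succ N ih =>
    rw [Finset.sum_Ioc_succ_top (Nat.zero_le N), ih, Nat.factorial_succ, Nat.cast_mul,
      Real.log_mul (by positivity) (by positivity), add_comm]

open ArithmeticFunction in
theorem sum_Ioc_log_eq_sum_vonMangoldt (N : ℕ) :
    ∑ n ∈ Ioc 0 N, Real.log n = ∑ q ∈ Ioc 0 N, vonMangoldt q * ((N / q : ℕ) : ℝ) := by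
  rw [← sum_Ioc_mul_zeta_eq_sum, vonMangoldt_mul_zeta]
  rfl

open ArithmeticFunction in
theorem exists_abs_sum_log_div_sub_log_le_nat :
    ∃ D : ℝ, ∀ N : ℕ, 1 ≤ N →
      |∑ p ∈ Ioc 0 N with p.Prime, Real.log p / p - Real.log N| ≤ D := by
  obtain ⟨B, hB0, hB⟩ := exists_sum_proper_primePow_le (a := fun n : ℕ => (n : ℝ)⁻¹) (C := 1)
    (β := 1) zero_le_one (by norm_num) (fun n _ => by rw [Real.rpow_neg_one, one_mul])
  refine ⟨Real.log 4 + 1 + B, fun N hN => ?_⟩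
  have hN0 : (0 : ℝ) < N := by exact_mod_cast hN
  have hl4 : 0 ≤ Real.log 4 := Real.log_nonneg (by norm_num)
  have hupper : (N : ℝ) * ∑ p ∈ Ioc 0 N with p.Prime, Real.log p / p ≤
      N * (Real.log N + Real.log 4) := by
    have h1 : ∑ n ∈ Ioc 0 N, Real.log n ≤ N * Real.log N := by
      have := Finset.sum_le_card_nsmul (Ioc 0 N) (fun n : ℕ => Real.log n) (Real.log N)
        fun n hn => Real.log_le_log (by exact_mod_cast (mem_Ioc.1 hn).1)
          (by exact_mod_cast (mem_Ioc.1 hn).2)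
      simpa using this
    have h2 : ∑ p ∈ Ioc 0 N with p.Prime, Real.log p ≤ Real.log 4 * N := by
      have := Chebyshev.theta_le_log4_mul_x (x := N) hN0.le
      rwa [Chebyshev.theta, Nat.floor_natCast] at this
    have h3 : ∑ p ∈ Ioc 0 N with p.Prime, Real.log p * ((N / p : ℕ) : ℝ) ≤
        ∑ n ∈ Ioc 0 N, Real.log n := by
      rw [sum_Ioc_log_eq_sum_vonMangoldt]
      refine le_trans (le_of_eq ?_) (Finset.sum_le_sum_of_subset_of_nonneg
        (Finset.filter_subset Nat.Prime _) fun q _ _ => mul_nonneg vonMangoldt_nonneg (by positivity))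
      refine Finset.sum_congr rfl fun p hp => ?_
      rw [vonMangoldt_apply_prime (mem_filter.1 hp).2]
    have h4 : (N : ℝ) * ∑ p ∈ Ioc 0 N with p.Prime, Real.log p / p ≤
        ∑ p ∈ Ioc 0 N with p.Prime, (Real.log p * ((N / p : ℕ) : ℝ) + Real.log p) := by
      rw [Finset.mul_sum]
      refine Finset.sum_le_sum fun p _ => ?_
      have : (N : ℝ) / p ≤ ((N / p : ℕ) : ℝ) + 1 := by
        rw [← Nat.floor_div_eq_div (K := ℝ)]
        exact (Nat.lt_floor_add_one _).le
      have := mul_le_mul_of_nonneg_left this (Real.log_natCast_nonneg p)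
      calc _ = Real.log p * (N / p) := by ring
        _ ≤ _ := this
        _ = _ := by ring
    rw [Finset.sum_add_distrib] at h4
    linarith
  have hlower : N * Real.log N - N ≤ (N : ℝ) * (∑ p ∈ Ioc 0 N with p.Prime, Real.log p / p + B) := by
    have h1 : N * Real.log N - N ≤ ∑ n ∈ Ioc 0 N, Real.log n := by
      rw [sum_Ioc_log_eq_log_factorial]
      have := Stirling.le_log_factorial_stirling (n := N) (by omega)
      have h2 : 0 ≤ Real.log (2 * Real.pi) := Real.log_nonneg (by linarith [Real.pi_gt_three])
      have h3 := Real.log_natCast_nonneg N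
      linarith
    refine h1.trans ?_
    rw [sum_Ioc_log_eq_sum_vonMangoldt]
    refine le_trans ?_ (mul_le_mul_of_nonneg_left (add_le_add le_rfl (hB N)) hN0.le)
    rw [Finset.sum_filter, Finset.sum_filter, ← Finset.sum_add_distrib, Finset.mul_sum]
    refine Finset.sum_le_sum fun q _ => ?_
    have hq : ((N / q : ℕ) : ℝ) ≤ N / q := Nat.cast_div_le
    have hq2 := mul_le_mul_of_nonneg_left hq (Real.log_natCast_nonneg q)
    by_cases h : q.Prime
    · rw [vonMangoldt_apply_prime h]
      simp only [h, not_true, and_false, if_true, if_false, add_zero]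
      calc _ ≤ _ := hq2
        _ = _ := by ring
    · by_cases h' : IsPrimePow q
      · simp only [h, h', not_false_eq_true, and_true, if_true, if_false, zero_add]
        calc _ ≤ Real.log q * ((N / q : ℕ) : ℝ) :=
              mul_le_mul_of_nonneg_right vonMangoldt_le_log (Nat.cast_nonneg _)
          _ ≤ _ := hq2
          _ = _ := by ring
      · simp [h, h', vonMangoldt_eq_zero_iff.2 h']
  have h1 := le_of_mul_le_mul_left hupper hN0
  have h2 : Real.log N - 1 ≤ ∑ p ∈ Ioc 0 N with p.Prime, Real.log p / p + B :=
    le_of_mul_le_mul_left (by linarith) hN0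
  rw [abs_le]
  constructor <;> linarith

/-- Mertens' first theorem. -/
theorem exists_abs_sum_log_div_sub_log_le :
    ∃ D : ℝ, ∀ w : ℝ, 1 ≤ w →
      |∑ p ∈ Ioc 0 ⌊w⌋₊ with p.Prime, Real.log p / p - Real.log w| ≤ D := by
  obtain ⟨D, hD⟩ := exists_abs_sum_log_div_sub_log_le_nat
  refine ⟨D + Real.log 2, fun w hw => ?_⟩
  have hN : 1 ≤ ⌊w⌋₊ := Nat.floor_pos.2 hw
  have hN0 : (1 : ℝ) ≤ ⌊w⌋₊ := by exact_mod_cast hN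
  have h1 : Real.log ⌊w⌋₊ ≤ Real.log w :=
    Real.log_le_log (by linarith) (Nat.floor_le (by linarith))
  have h2 : Real.log w ≤ Real.log 2 + Real.log ⌊w⌋₊ := by
    rw [← Real.log_mul (by norm_num) (by linarith)]
    exact Real.log_le_log (by linarith) (by linarith [Nat.lt_floor_add_one w])
  have h3 := abs_le.1 (hD _ hN)
  rw [abs_le]
  constructor <;> linarith

theorem summable_prime_pow {a : ℕ → ℝ} {C β : ℝ} (hβ : 0 < β) (hnn : ∀ n, 0 ≤ a n)
    (ha : ∀ n : ℕ, 1 ≤ n → a n ≤ C * (n : ℝ) ^ (-β)) {p : ℕ} (hp : p.Prime) :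
    Summable fun r : ℕ => a (p ^ r) := by
  refine Summable.of_nonneg_of_le (fun r => hnn _) (fun r => ?_)
    ((summable_geometric_of_lt_one (by positivity : 0 ≤ (p : ℝ) ^ (-β))
      ((prime_rpow_neg_le hp hβ).trans_lt (two_rpow_neg_lt_one hβ))).mul_left C)
  rw [← rpow_prime_pow]
  exact ha _ (Nat.one_le_pow _ _ hp.pos)

theorem one_le_tsum_prime_pow {a : ℕ → ℝ} {C β : ℝ} (hβ : 0 < β) (ha1 : a 1 = 1)
    (hnn : ∀ n, 0 ≤ a n) (ha : ∀ n : ℕ, 1 ≤ n → a n ≤ C * (n : ℝ) ^ (-β)) {p : ℕ}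
    (hp : p.Prime) : 1 ≤ ∑' r : ℕ, a (p ^ r) := by
  have := (summable_prime_pow hβ hnn ha hp).le_tsum 0 fun r _ => hnn _
  simpa [ha1] using this

theorem abs_log_tsum_prime_pow_sub_le {a : ℕ → ℝ} {C β : ℝ} (hC : 0 ≤ C) (hβ : 0 < β)
    (ha1 : a 1 = 1) (hnn : ∀ n, 0 ≤ a n) (ha : ∀ n : ℕ, 1 ≤ n → a n ≤ C * (n : ℝ) ^ (-β))
    {p : ℕ} (hp : p.Prime) :
    |Real.log (∑' r : ℕ, a (p ^ r)) - a p| ≤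
      (C / (1 - (2 : ℝ) ^ (-β)) + (C / (1 - (2 : ℝ) ^ (-β))) ^ 2) * (p : ℝ) ^ (-(2 * β)) := by
  have h2 := two_rpow_neg_lt_one hβ
  have hp2 := prime_rpow_neg_le hp hβ
  have hy0 : 0 ≤ (p : ℝ) ^ (-β) := by positivity
  have hy2 : (p : ℝ) ^ (-(2 * β)) = ((p : ℝ) ^ (-β)) ^ 2 := by
    rw [← Real.rpow_natCast, ← Real.rpow_mul (Nat.cast_nonneg _)]
    congr 1
    push_cast
    ring
  rw [hy2]
  set y := (p : ℝ) ^ (-β) with hy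
  have hy1 : y < 1 := hp2.trans_lt h2
  set E := C / (1 - (2 : ℝ) ^ (-β)) with hE
  have hE0 : 0 ≤ E := div_nonneg hC (by linarith)
  have hs := summable_prime_pow hβ hnn ha hp
  have htail : ∀ k : ℕ, ∑' r : ℕ, a (p ^ (r + k)) ≤ E * y ^ k := by
    intro k
    have hg := (summable_geometric_of_lt_one hy0 hy1).mul_left (C * y ^ k)
    calc ∑' r : ℕ, a (p ^ (r + k)) ≤ ∑' r : ℕ, C * y ^ k * y ^ r := by
          refine ((summable_nat_add_iff k).2 hs).tsum_le_tsum (fun r => ?_) hg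
          have := ha (p ^ (r + k)) (Nat.one_le_pow _ _ hp.pos)
          rw [rpow_prime_pow] at this
          refine this.trans (le_of_eq ?_)
          rw [← hy]
          ring
      _ = C * y ^ k * (1 - y)⁻¹ := by rw [tsum_mul_left, tsum_geometric_of_lt_one hy0 hy1]
      _ ≤ C * y ^ k * (1 - (2 : ℝ) ^ (-β))⁻¹ := by
          refine mul_le_mul_of_nonneg_left ?_ (by positivity)
          exact inv_anti₀ (by linarith) (by linarith)
      _ = E * y ^ k := by rw [hE]; ring
  have hX : ∑' r : ℕ, a (p ^ r) = 1 + ∑' r : ℕ, a (p ^ (r + 1)) := by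
    rw [hs.tsum_eq_zero_add, pow_zero, ha1]
  have hX2 : ∑' r : ℕ, a (p ^ (r + 1)) = a p + ∑' r : ℕ, a (p ^ (r + 2)) := by
    rw [((summable_nat_add_iff 1).2 hs).tsum_eq_zero_add, zero_add, pow_one]
  have ht1 := htail 1
  have ht2 := htail 2
  have hT0 : 0 ≤ ∑' r : ℕ, a (p ^ (r + 2)) := tsum_nonneg fun _ => hnn _
  have hap := hnn p
  rw [hX]
  rw [pow_one] at ht1
  set X := ∑' r : ℕ, a (p ^ (r + 1)) with hXdef
  have hX0 : 0 ≤ X := tsum_nonneg fun _ => hnn _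
  have hup := Real.log_le_sub_one_of_pos (show 0 < 1 + X by linarith)
  have hlow : X - X ^ 2 ≤ Real.log (1 + X) := by
    refine le_trans ?_ (Real.one_sub_inv_le_log_of_pos (by linarith))
    have : 1 - (1 + X)⁻¹ - (X - X ^ 2) = X ^ 3 / (1 + X) := by field_simp; ring
    have : 0 ≤ X ^ 3 / (1 + X) := by positivity
    linarith
  have hXX : X ^ 2 ≤ E ^ 2 * y ^ 2 := by
    rw [← mul_pow]
    exact pow_le_pow_left₀ hX0 ht1 2
  have : 0 ≤ E * y ^ 2 := by positivity
  have : 0 ≤ E ^ 2 * y ^ 2 := by positivity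
  rw [abs_le]
  constructor <;> nlinarith

theorem abs_log_one_sub_add_le {z : ℝ} (h1 : z ≤ 1 / 2) :
    |Real.log (1 - z) + z| ≤ 2 * z ^ 2 := by
  have hup := Real.log_le_sub_one_of_pos (show 0 < 1 - z by linarith)
  have hlow := Real.one_sub_inv_le_log_of_pos (show 0 < 1 - z by linarith)
  have : 1 - (1 - z)⁻¹ - (-z - 2 * z ^ 2) = z ^ 2 * (1 - 2 * z) / (1 - z) := by
    have : 1 - z ≠ 0 := by linarith
    field_simp
    ring
  have : 0 ≤ z ^ 2 * (1 - 2 * z) / (1 - z) :=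
    div_nonneg (mul_nonneg (sq_nonneg _) (by linarith)) (by linarith)
  rw [abs_le]
  constructor <;> nlinarith [sq_nonneg z]

/-- The difference `a p - κ / p` at primes `p`, and zero elsewhere. -/
noncomputable def primeDefect (a : ℕ → ℝ) (κ : ℝ) (n : ℕ) : ℝ :=
  if n.Prime then a n - κ / n else 0

/-- The contribution of the squares and higher powers of primes to the logarithm of the Euler
product of `F(s) / ζ(1 + s) ^ κ`, where `F` is the Dirichlet series of `a`. -/
noncomputable def eulerRest (a : ℕ → ℝ) (κ s : ℝ) (p : ℕ) : ℝ :=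
  if p.Prime then
    κ * Real.log (1 - (p : ℝ) ^ (-(1 + s))) +
      Real.log (∑' r : ℕ, a (p ^ r) * ((p ^ r : ℕ) : ℝ) ^ (-s)) - (a p - κ / p) * (p : ℝ) ^ (-s)
  else 0

theorem mul_rpow_neg_le {a : ℕ → ℝ} (hnn : ∀ n, 0 ≤ a n) {s : ℝ} (hs : 0 ≤ s) {n : ℕ}
    (hn : 1 ≤ n) : a n * (n : ℝ) ^ (-s) ≤ a n :=
  mul_le_of_le_one_right (hnn n)
    (Real.rpow_le_one_of_one_le_of_nonpos (by exact_mod_cast hn) (by linarith))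

theorem prime_rpow_neg_one_add_le {p : ℕ} (hp : p.Prime) {s : ℝ} (hs : 0 ≤ s) :
    (p : ℝ) ^ (-(1 + s)) ≤ (p : ℝ)⁻¹ := by
  rw [← Real.rpow_neg_one]
  exact Real.rpow_le_rpow_of_exponent_le (by exact_mod_cast hp.one_le) (by linarith)

theorem prime_inv_le_half {p : ℕ} (hp : p.Prime) : (p : ℝ)⁻¹ ≤ 1 / 2 := by
  rw [one_div]
  exact inv_anti₀ (by norm_num) (by exact_mod_cast hp.two_le)

theorem abs_eulerRest_le {a : ℕ → ℝ} {C β κ s : ℝ} (hκ : 0 ≤ κ) (hC : 0 ≤ C) (hβ : 0 < β)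
    (ha1 : a 1 = 1) (hnn : ∀ n, 0 ≤ a n) (ha : ∀ n : ℕ, 1 ≤ n → a n ≤ C * (n : ℝ) ^ (-β))
    (hs : 0 ≤ s) (p : ℕ) :
    |eulerRest a κ s p| ≤
      (C / (1 - (2 : ℝ) ^ (-β)) + (C / (1 - (2 : ℝ) ^ (-β))) ^ 2) * (p : ℝ) ^ (-(2 * β)) +
        2 * κ * (p : ℝ) ^ (-2 : ℝ) := by
  have hE0 : 0 ≤ C / (1 - (2 : ℝ) ^ (-β)) :=
    div_nonneg hC (by linarith [two_rpow_neg_lt_one hβ])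
  by_cases hp : p.Prime
  · rw [eulerRest, if_pos hp]
    have hp0 : (0 : ℝ) < p := by exact_mod_cast hp.pos
    have h1 := abs_log_tsum_prime_pow_sub_le (a := fun n => a n * (n : ℝ) ^ (-s)) hC hβ
      (by simp [ha1]) (fun n => mul_nonneg (hnn n) (by positivity))
      (fun n hn => (mul_rpow_neg_le hnn hs hn).trans (ha n hn)) hp
    have hz := prime_rpow_neg_one_add_le hp hs
    have h2 := abs_log_one_sub_add_le (hz.trans (prime_inv_le_half hp))
    have h3 : ((p : ℝ) ^ (-(1 + s))) ^ 2 ≤ (p : ℝ) ^ (-2 : ℝ) := by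
      rw [Real.rpow_neg hp0.le 2, Real.rpow_two, ← inv_pow]
      exact pow_le_pow_left₀ (by positivity) hz 2
    have h4 : (p : ℝ) ^ (-(1 + s)) = (p : ℝ)⁻¹ * (p : ℝ) ^ (-s) := by
      rw [neg_add, Real.rpow_add hp0, Real.rpow_neg_one]
    have h5 : |κ * (Real.log (1 - (p : ℝ) ^ (-(1 + s))) + (p : ℝ) ^ (-(1 + s)))| ≤
        2 * κ * (p : ℝ) ^ (-2 : ℝ) := by
      rw [abs_mul, abs_of_nonneg hκ]
      nlinarith
    refine le_trans (le_of_eq ?_) ((abs_add_le _ _).trans (add_le_add h1 h5))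
    congr 1
    rw [h4]
    ring
  · rw [eulerRest, if_neg hp, abs_zero]
    positivity

theorem summable_eulerRest_bound {β : ℝ} (hβ : 1 / 2 < β) (E κ : ℝ) :
    Summable fun n : ℕ => E * (n : ℝ) ^ (-(2 * β)) + 2 * κ * (n : ℝ) ^ (-2 : ℝ) :=
  ((Real.summable_nat_rpow.2 (by linarith)).mul_left _).add
    ((Real.summable_nat_rpow.2 (by norm_num)).mul_left _)

theorem prod_eulerFactor_eq_exp {a : ℕ → ℝ} {C β κ s : ℝ} (hβ : 0 < β)
    (ha1 : a 1 = 1) (hnn : ∀ n, 0 ≤ a n) (ha : ∀ n : ℕ, 1 ≤ n → a n ≤ C * (n : ℝ) ^ (-β))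
    (hs : 0 ≤ s) (N : ℕ) :
    ∏ p ∈ range N with p.Prime, (1 - (p : ℝ) ^ (-(1 + s))) ^ κ *
        ∑' r : ℕ, a (p ^ r) * ((p ^ r : ℕ) : ℝ) ^ (-s) =
      Real.exp (∑ p ∈ range N, primeDefect a κ p * (p : ℝ) ^ (-s) +
        ∑ p ∈ range N, eulerRest a κ s p) := by
  rw [← Finset.sum_add_distrib, Real.exp_sum, Finset.prod_filter]
  refine Finset.prod_congr rfl fun p _ => ?_
  by_cases hp : p.Prime
  · rw [if_pos hp, primeDefect, if_pos hp, eulerRest, if_pos hp]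
    have hz := (prime_rpow_neg_one_add_le hp hs).trans (prime_inv_le_half hp)
    have hL := one_le_tsum_prime_pow (a := fun n => a n * (n : ℝ) ^ (-s)) (C := C) hβ
      (by simp [ha1]) (fun n => mul_nonneg (hnn n) (by positivity))
      (fun n hn => (mul_rpow_neg_le hnn hs hn).trans (ha n hn)) hp
    rw [add_sub_cancel, Real.exp_add, Real.exp_log (by linarith),
      Real.rpow_def_of_pos (by linarith), mul_comm κ]
  · simp [primeDefect, eulerRest, hp]

theorem tendsto_eulerRest {a : ℕ → ℝ} {C β : ℝ} (κ : ℝ) (hβ : 0 < β)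
    (ha1 : a 1 = 1) (hnn : ∀ n, 0 ≤ a n) (ha : ∀ n : ℕ, 1 ≤ n → a n ≤ C * (n : ℝ) ^ (-β))
    (p : ℕ) :
    Tendsto (fun s => eulerRest a κ s p) (nhdsWithin 0 (Set.Ioi 0)) (nhds (eulerRest a κ 0 p)) := by
  by_cases hp : p.Prime
  · simp only [eulerRest, if_pos hp]
    have hp0 : (p : ℝ) ≠ 0 := by exact_mod_cast hp.ne_zero
    have hc : ∀ n : ℕ, n ≠ 0 → Continuous fun s : ℝ => (n : ℝ) ^ (-s) := fun n hn =>
      continuous_const.rpow continuous_neg fun _ => Or.inl (by exact_mod_cast hn)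
    have hT : Tendsto (fun s : ℝ => ∑' r : ℕ, a (p ^ r) * ((p ^ r : ℕ) : ℝ) ^ (-s))
        (nhdsWithin 0 (Set.Ioi 0)) (nhds (∑' r : ℕ, a (p ^ r) * ((p ^ r : ℕ) : ℝ) ^ (-(0 : ℝ)))) := by
      refine tendsto_tsum_of_dominated_convergence (summable_prime_pow hβ hnn ha hp)
        (fun r => ?_) ?_
      · exact (((hc (p ^ r) (pow_ne_zero _ hp.ne_zero)).const_mul
          (a (p ^ r))).tendsto 0).mono_left nhdsWithin_le_nhds
      · filter_upwards [self_mem_nhdsWithin] with s hs r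
        rw [Real.norm_of_nonneg (mul_nonneg (hnn _) (by positivity))]
        exact mul_rpow_neg_le hnn (le_of_lt hs) (Nat.one_le_pow _ _ hp.pos)
    have hL := one_le_tsum_prime_pow (a := fun n => a n * (n : ℝ) ^ (-(0 : ℝ))) (C := C) hβ
      (by simp [ha1]) (fun n => mul_nonneg (hnn n) (by positivity))
      (fun n hn => (mul_rpow_neg_le hnn le_rfl hn).trans (ha n hn)) hp
    have hz := (prime_rpow_neg_one_add_le hp le_rfl).trans (prime_inv_le_half hp)
    have h1 : Tendsto (fun s : ℝ => (p : ℝ) ^ (-(1 + s))) (nhdsWithin 0 (Set.Ioi 0))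
        (nhds ((p : ℝ) ^ (-(1 + (0 : ℝ))))) :=
      (((hc p hp.ne_zero).comp (continuous_const.add continuous_id)).tendsto 0).mono_left
        nhdsWithin_le_nhds
    have h2 : Tendsto (fun s : ℝ => (p : ℝ) ^ (-s)) (nhdsWithin 0 (Set.Ioi 0))
        (nhds ((p : ℝ) ^ (-(0 : ℝ)))) :=
      ((hc p hp.ne_zero).tendsto 0).mono_left nhdsWithin_le_nhds
    exact ((((tendsto_const_nhds.sub h1).log
      (sub_pos.2 (hz.trans_lt (by norm_num))).ne').const_mul κ).add
      (hT.log (zero_lt_one.trans_le hL).ne')).sub (h2.const_mul _)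
  · simp only [eulerRest, if_neg hp]
    exact tendsto_const_nhds

theorem tendsto_tsum_eulerRest {a : ℕ → ℝ} {C β κ : ℝ} (hκ : 0 ≤ κ) (hC : 0 ≤ C)
    (hβ : 1 / 2 < β) (ha1 : a 1 = 1) (hnn : ∀ n, 0 ≤ a n)
    (ha : ∀ n : ℕ, 1 ≤ n → a n ≤ C * (n : ℝ) ^ (-β)) :
    Tendsto (fun s => ∑' p, eulerRest a κ s p) (nhdsWithin 0 (Set.Ioi 0))
      (nhds (∑' p, eulerRest a κ 0 p)) := by
  have hβ0 : 0 < β := by linarith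
  refine tendsto_tsum_of_dominated_convergence (summable_eulerRest_bound hβ
    (C / (1 - (2 : ℝ) ^ (-β)) + (C / (1 - (2 : ℝ) ^ (-β))) ^ 2) κ) (tendsto_eulerRest κ hβ0 ha1 hnn ha) ?_
  filter_upwards [self_mem_nhdsWithin] with s hs p
  exact abs_eulerRest_le hκ hC hβ0 ha1 hnn ha (le_of_lt hs) p

theorem summable_eulerRest {a : ℕ → ℝ} {C β κ s : ℝ} (hκ : 0 ≤ κ) (hC : 0 ≤ C)
    (hβ : 1 / 2 < β) (ha1 : a 1 = 1) (hnn : ∀ n, 0 ≤ a n)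
    (ha : ∀ n : ℕ, 1 ≤ n → a n ≤ C * (n : ℝ) ^ (-β)) (hs : 0 ≤ s) :
    Summable (eulerRest a κ s) :=
  .of_norm_bounded (summable_eulerRest_bound hβ _ κ)
    (abs_eulerRest_le hκ hC (by linarith) ha1 hnn ha hs)

theorem exists_tendsto_sum_primeDefect {a : ℕ → ℝ} {κ D : ℝ} (hκ : 0 ≤ κ)
    (hD : ∀ w : ℝ, 1 ≤ w →
      |∑ p ∈ Ioc 0 ⌊w⌋₊ with p.Prime, a p * Real.log p - κ * Real.log w| ≤ D) :
    ∃ B, Tendsto (fun N : ℕ => ∑ n ∈ range N, primeDefect a κ n) atTop (nhds B) := by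
  obtain ⟨M, hM⟩ := exists_abs_sum_log_div_sub_log_le
  have hD0 : 0 ≤ D := (abs_nonneg _).trans (hD 1 le_rfl)
  have hM0 : 0 ≤ M := (abs_nonneg _).trans (hM 1 le_rfl)
  have hanti : Antitone fun n : ℕ => (Real.log (max n 2))⁻¹ := fun m n hmn =>
    inv_anti₀ (Real.log_pos (lt_max_of_lt_right one_lt_two))
      (Real.log_le_log (lt_max_of_lt_right two_pos)
        (max_le_max (Nat.cast_le.2 hmn) le_rfl))
  have hzero : Tendsto (fun n : ℕ => (Real.log (max n 2))⁻¹) atTop (nhds 0) :=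
    tendsto_inv_atTop_zero.comp (Real.tendsto_log_atTop.comp
      (tendsto_atTop_mono (fun n => le_max_left _ _) tendsto_natCast_atTop_atTop))
  have hbdd : ∀ N : ℕ, ‖∑ n ∈ range N, primeDefect a κ n * Real.log n‖ ≤ D + κ * M := by
    intro N
    rcases N with _ | N
    · simpa using by positivity
    rcases Nat.eq_zero_or_pos N with rfl | hN
    · simpa using by positivity
    have hN1 : (1 : ℝ) ≤ N := by exact_mod_cast hN
    have h1 := hD N hN1
    have h2 := hM N hN1
    rw [Nat.floor_natCast] at h1 h2
    have h3 : ∑ n ∈ range (N + 1), primeDefect a κ n * Real.log n =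
        (∑ p ∈ Ioc 0 N with p.Prime, a p * Real.log p - κ * Real.log N) -
          κ * (∑ p ∈ Ioc 0 N with p.Prime, Real.log p / p - Real.log N) := by
      rw [Finset.range_eq_Ico, Finset.sum_eq_sum_Ico_succ_bot (Nat.succ_pos N), Nat.cast_zero,
        Real.log_zero, mul_zero, zero_add, mul_sub, sub_sub_sub_cancel_right, Finset.mul_sum,
        ← Finset.sum_sub_distrib, Finset.sum_filter]
      refine Finset.sum_congr rfl fun n _ => ?_
      by_cases hn : n.Prime
      · simp only [primeDefect, hn, if_true]
        ring
      · simp [primeDefect, hn]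
    rw [h3]
    refine (norm_sub_le _ _).trans (add_le_add h1 ?_)
    rw [norm_mul, Real.norm_of_nonneg hκ]
    exact mul_le_mul_of_nonneg_left h2 hκ
  obtain ⟨B, hB⟩ := cauchySeq_tendsto_of_complete
    (hanti.cauchySeq_series_mul_of_tendsto_zero_of_bounded hzero hbdd)
  refine ⟨B, hB.congr fun N => Finset.sum_congr rfl fun n _ => ?_⟩
  by_cases hn : n.Prime
  · have h2 : (2 : ℝ) ≤ n := by exact_mod_cast hn.two_le
    have := Real.log_pos (show (1 : ℝ) < n by linarith)
    rw [max_eq_left h2, smul_eq_mul]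
    field_simp
  · simp [primeDefect, hn]

theorem summable_abs_primeDefect_mul_rpow_neg {a : ℕ → ℝ} {κ s : ℝ} (hκ : 0 ≤ κ)
    (hnn : ∀ n, 0 ≤ a n) (hs : 0 < s) (hsum : Summable fun n : ℕ => a n * (n : ℝ) ^ (-s)) :
    Summable fun n : ℕ => |primeDefect a κ n| * (n : ℝ) ^ (-s) := by
  have hζ : Summable fun n : ℕ => κ * (n : ℝ) ^ (-(1 + s)) :=
    (Real.summable_nat_rpow.2 (by linarith)).mul_left κ
  refine Summable.of_nonneg_of_le (fun n => by positivity) (fun n => ?_) (hsum.add hζ)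
  by_cases hn : n.Prime
  · have hn0 : (0 : ℝ) < n := by exact_mod_cast hn.pos
    rw [primeDefect, if_pos hn, neg_add, Real.rpow_add hn0, Real.rpow_neg_one, ← mul_assoc,
      ← add_mul, ← div_eq_mul_inv]
    refine mul_le_mul_of_nonneg_right ?_ (by positivity)
    refine (abs_sub _ _).trans (le_of_eq ?_)
    rw [abs_of_nonneg (hnn n), abs_of_nonneg (by positivity)]
  · rw [primeDefect, if_neg hn, abs_zero, zero_mul]
    exact add_nonneg (mul_nonneg (hnn n) (by positivity)) (by positivity)

theorem tendsto_expSum_of_tendsto_sum_range {f : ℕ → ℝ} {B : ℝ} (hf0 : f 0 = 0)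
    (h : Tendsto (fun N : ℕ => ∑ n ∈ range N, f n) atTop (nhds B)) :
    Tendsto (expSum f) atTop (nhds B) := by
  refine (((tendsto_add_atTop_iff_nat 1).2 h).comp
    (tendsto_nat_floor_atTop.comp Real.tendsto_exp_atTop)).congr fun u => ?_
  simp only [Function.comp_apply, expSum]
  rw [Finset.range_eq_Ico, Finset.sum_eq_sum_Ico_succ_bot (Nat.succ_pos _), hf0, zero_add]
  rfl

theorem tendsto_tsum_primeDefect {a : ℕ → ℝ} {κ B : ℝ} (hκ : 0 ≤ κ) (hnn : ∀ n, 0 ≤ a n)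
    (hsum : ∀ s : ℝ, 0 < s → Summable fun n : ℕ => a n * (n : ℝ) ^ (-s))
    (hB : Tendsto (fun N : ℕ => ∑ n ∈ range N, primeDefect a κ n) atTop (nhds B)) :
    Tendsto (fun s : ℝ => ∑' n : ℕ, primeDefect a κ n * (n : ℝ) ^ (-s))
      (nhdsWithin 0 (Set.Ioi 0)) (nhds B) := by
  have h0 : primeDefect a κ 0 = 0 := by simp [primeDefect, Nat.not_prime_zero]
  have := tendsto_rpow_mul_tsum_mul_rpow_neg (κ := 0) (c := B) le_rfl h0
    (fun s hs => summable_abs_primeDefect_mul_rpow_neg hκ hnn hs (hsum s hs))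
    (by simpa using tendsto_expSum_of_tendsto_sum_range h0 hB)
  simpa using this

theorem tendsto_prod_one_sub_prime_rpow_neg {s : ℝ} (hs : 0 < s) :
    Tendsto (fun N : ℕ => ∏ p ∈ range N with p.Prime, (1 - (p : ℝ) ^ (-(1 + s)))⁻¹) atTop
      (nhds (∑' n : ℕ, (n : ℝ) ^ (-(1 + s)))) := by
  have hsum : Summable fun n : ℕ => (n : ℝ) ^ (-(1 + s)) :=
    Real.summable_nat_rpow.2 (by linarith)
  refine (EulerProduct.eulerProduct (f := fun n : ℕ => (n : ℝ) ^ (-(1 + s))) (by simp)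
    (fun {m n} _ => ?_) hsum.norm ?_).congr fun N => Finset.prod_congr rfl fun p hp => ?_
  · rw [Nat.cast_mul, Real.mul_rpow (Nat.cast_nonneg _) (Nat.cast_nonneg _)]
  · rw [Nat.cast_zero, Real.zero_rpow (by linarith)]
  · have hp := (mem_filter.1 hp).2
    simp only [rpow_prime_pow]
    exact tsum_geometric_of_lt_one (by positivity)
      ((prime_rpow_neg_le hp (by linarith)).trans_lt (two_rpow_neg_lt_one (by linarith)))

theorem exp_tsum_primeDefect_add_eq {a : ℕ → ℝ} {C β κ s : ℝ} (hκ : 0 ≤ κ) (hC : 0 ≤ C)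
    (hβ : 1 / 2 < β) (ha0 : a 0 = 0) (ha1 : a 1 = 1)
    (hmul : ∀ m n : ℕ, Nat.Coprime m n → a (m * n) = a m * a n) (hnn : ∀ n, 0 ≤ a n)
    (ha : ∀ n : ℕ, 1 ≤ n → a n ≤ C * (n : ℝ) ^ (-β)) (hs : 0 < s)
    (hsum : Summable fun n : ℕ => a n * (n : ℝ) ^ (-s)) :
    Real.exp (∑' n : ℕ, primeDefect a κ n * (n : ℝ) ^ (-s) + ∑' p, eulerRest a κ s p) =
      (∑' n : ℕ, (n : ℝ) ^ (-(1 + s)))⁻¹ ^ κ * ∑' n : ℕ, a n * (n : ℝ) ^ (-s) := by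
  have hb : Summable fun n : ℕ => primeDefect a κ n * (n : ℝ) ^ (-s) := by
    refine .of_norm ((summable_abs_primeDefect_mul_rpow_neg hκ hnn hs hsum).congr fun n => ?_)
    rw [norm_mul, Real.norm_eq_abs, Real.norm_of_nonneg (by positivity)]
  have h1 := (Real.continuous_exp.tendsto _).comp
    (hb.hasSum.tendsto_sum_nat.add
      (summable_eulerRest hκ hC hβ ha1 hnn ha hs.le).hasSum.tendsto_sum_nat)
  have hF := EulerProduct.eulerProduct (f := fun n : ℕ => a n * (n : ℝ) ^ (-s)) (by simp [ha1])
    (fun {m n} h => by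
      rw [hmul m n h, Nat.cast_mul, Real.mul_rpow (Nat.cast_nonneg _) (Nat.cast_nonneg _)]
      ring) hsum.norm (by simp [ha0])
  have hZ : 0 < ∑' n : ℕ, (n : ℝ) ^ (-(1 + s)) :=
    (Real.summable_nat_rpow.2 (by linarith)).tsum_pos (fun n => by positivity) 1 (by simp)
  have h2 := (((tendsto_prod_one_sub_prime_rpow_neg hs).inv₀ hZ.ne').rpow_const (p := κ)
    (Or.inl (inv_pos.2 hZ).ne')).mul hF
  refine tendsto_nhds_unique h1 (h2.congr fun N => ?_)
  simp only [Function.comp_apply]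
  rw [← prod_eulerFactor_eq_exp (by linarith) ha1 hnn ha hs.le, Finset.prod_mul_distrib,
    ← Finset.prod_inv_distrib, Nat.primesBelow, ← Real.finsetProd_rpow]
  · simp only [inv_inv]
  · intro p hp
    rw [inv_inv]
    linarith [(prime_rpow_neg_one_add_le (mem_filter.1 hp).2 hs.le).trans
      (prime_inv_le_half (mem_filter.1 hp).2)]

theorem tendsto_mul_tsum_rpow_neg_one_add :
    Tendsto (fun s : ℝ => s * ∑' n : ℕ, (n : ℝ) ^ (-(1 + s))) (nhdsWithin 0 (Set.Ioi 0))
      (nhds 1) := by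
  have h : Tendsto (fun s : ℝ => 1 + s) (nhdsWithin 0 (Set.Ioi 0)) (nhdsWithin 1 (Set.Ioi 1)) := by
    refine tendsto_nhdsWithin_iff.2 ⟨?_, ?_⟩
    · have : Tendsto (fun s : ℝ => 1 + s) (nhds 0) (nhds (1 + 0)) :=
        (continuous_const.add continuous_id).tendsto 0
      rw [add_zero] at this
      exact this.mono_left nhdsWithin_le_nhds
    · filter_upwards [self_mem_nhdsWithin] with s hs
      exact lt_add_of_pos_right 1 (Set.mem_Ioi.1 hs)
  refine (tendsto_sub_mul_tsum_nat_rpow.comp h).congr fun s => ?_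
  simp only [Function.comp_apply, add_sub_cancel_left, one_div]
  congr 1
  exact tsum_congr fun n => (Real.rpow_neg (Nat.cast_nonneg n) _).symm

theorem tendsto_prod_eulerFactor {a : ℕ → ℝ} {C β κ c D : ℝ} (hκ : 0 ≤ κ) (hC : 0 ≤ C)
    (hβ : 1 / 2 < β) (ha0 : a 0 = 0) (ha1 : a 1 = 1)
    (hmul : ∀ m n : ℕ, Nat.Coprime m n → a (m * n) = a m * a n) (hnn : ∀ n, 0 ≤ a n)
    (ha : ∀ n : ℕ, 1 ≤ n → a n ≤ C * (n : ℝ) ^ (-β))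
    (hD : ∀ w : ℝ, 1 ≤ w →
      |∑ p ∈ Ioc 0 ⌊w⌋₊ with p.Prime, a p * Real.log p - κ * Real.log w| ≤ D)
    (hlim : Tendsto (fun u => expSum a u / u ^ κ) atTop (nhds c)) :
    Tendsto (fun N : ℕ => ∏ p ∈ range N with p.Prime,
      (1 - 1 / (p : ℝ)) ^ κ * ∑' r : ℕ, a (p ^ r)) atTop (nhds (Real.Gamma (κ + 1) * c)) := by
  have hβ0 : 0 < β := by linarith
  obtain ⟨B, hB⟩ := exists_tendsto_sum_primeDefect hκ hD
  have hsum : ∀ s : ℝ, 0 < s → Summable fun n : ℕ => a n * (n : ℝ) ^ (-s) := fun s hs =>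
    summable_mul_rpow_neg_of_tendsto hnn hlim hs
  have hF := tendsto_rpow_mul_tsum_mul_rpow_neg hκ ha0
    (fun s hs => (hsum s hs).congr fun n => by rw [abs_of_nonneg (hnn n)]) hlim
  have hZ := (tendsto_mul_tsum_rpow_neg_one_add.inv₀ one_ne_zero).rpow_const (p := κ)
    (Or.inl (inv_ne_zero one_ne_zero))
  rw [inv_one, Real.one_rpow] at hZ
  have hexp := (Real.continuous_exp.tendsto _).comp
    ((tendsto_tsum_primeDefect hκ hnn hsum hB).add
      (tendsto_tsum_eulerRest hκ hC hβ ha1 hnn ha))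
  have hval : Real.exp (B + ∑' p, eulerRest a κ 0 p) = Real.Gamma (κ + 1) * c := by
    rw [mul_comm, ← one_mul (c * _)]
    refine tendsto_nhds_unique hexp ((hZ.mul hF).congr' ?_)
    filter_upwards [self_mem_nhdsWithin] with s hs
    have hs : 0 < s := hs
    have hp := Real.rpow_pos_of_pos hs κ
    simp only [Function.comp_apply]
    rw [exp_tsum_primeDefect_add_eq hκ hC hβ ha0 ha1 hmul hnn ha hs (hsum s hs), mul_inv,
      Real.mul_rpow (by positivity) (inv_nonneg.2 (tsum_nonneg fun n => by positivity)),
      Real.inv_rpow hs.le]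
    field_simp
  rw [← hval]
  refine ((Real.continuous_exp.tendsto _).comp (hB.add
    (summable_eulerRest hκ hC hβ ha1 hnn ha le_rfl).hasSum.tendsto_sum_nat)).congr fun N => ?_
  have := prod_eulerFactor_eq_exp (κ := κ) hβ0 ha1 hnn ha le_rfl N
  simp only [neg_zero, Real.rpow_zero, mul_one, add_zero, Real.rpow_neg_one] at this
  simp only [one_div]
  exact this.symm

theorem tendsto_expSum_div_rpow {a : ℕ → ℝ} {κ c K : ℝ}
    (h : ∀ u, Real.log 2 ≤ u → |expSum a u - c * u ^ κ| ≤ K * u ^ (κ - 1)) :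
    Tendsto (fun u => expSum a u / u ^ κ) atTop (nhds c) := by
  rw [tendsto_iff_norm_sub_tendsto_zero]
  have hK : Tendsto (fun u : ℝ => K * u⁻¹) atTop (nhds 0) := by
    simpa using tendsto_inv_atTop_zero.const_mul K
  refine squeeze_zero' (Eventually.of_forall fun u => norm_nonneg _) ?_ hK
  filter_upwards [eventually_ge_atTop (Real.log 2)] with u hu
  have hu0 : 0 < u := (Real.log_pos one_lt_two).trans_le hu
  have hp := Real.rpow_pos_of_pos hu0 κ
  have h1 := h u hu
  rw [Real.rpow_sub_one hu0.ne'] at h1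
  rw [Real.norm_eq_abs, div_sub' hp.ne', abs_div, abs_of_pos hp, div_le_iff₀ hp, mul_comm (u ^ κ)]
  refine h1.trans (le_of_eq ?_)
  ring

/-- Proposition C(a): for nonnegative multiplicative `g` with
`g(n) ≪ n^α`, `α < 1/2`, and `∑_{p≤w} g(p)(log p)/p = κ log w + O(1)` for real
`κ ≥ 0`, one has `∑_{n≤x} g(n)/n = c(g)(log x)^κ + O((log x)^{κ−1})`, where
`c(g) = Γ(κ+1)⁻¹ ∏_p (1−1/p)^κ (1 + g(p)/p + g(p²)/p² + ⋯)`. -/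
theorem stmt_15 (g : ℕ → ℝ) (hg1 : g 1 = 1)
    (hmul : ∀ m n : ℕ, Nat.Coprime m n → g (m * n) = g m * g n)
    (hnn : ∀ n, 0 ≤ g n) (α : ℝ) (hα : α < 1 / 2)
    (hbd : ∃ C : ℝ, ∀ n : ℕ, 1 ≤ n → g n ≤ C * (n : ℝ) ^ α)
    (κ : ℝ) (hκ : 0 ≤ κ)
    (hmertens : ∃ C : ℝ, ∀ w : ℝ, 2 ≤ w →
      |(∑ p ∈ (Finset.range (⌊w⌋₊ + 1)).filter Nat.Prime,
          g p * Real.log p / p) - κ * Real.log w| ≤ C) :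
    ∃ c : ℝ,
      Tendsto (fun N : ℕ =>
          ∏ p ∈ (Finset.range N).filter Nat.Prime,
            (1 - 1 / (p : ℝ)) ^ κ * ∑' r : ℕ, g (p ^ r) / ((p : ℝ) ^ r))
        atTop (nhds (Real.Gamma (κ + 1) * c)) ∧
      ∃ C : ℝ, ∀ x : ℝ, 2 ≤ x →
        |(∑ n ∈ Finset.Icc 1 ⌊x⌋₊, g n / n) - c * Real.log x ^ κ|
          ≤ C * Real.log x ^ (κ - 1) := by
  obtain ⟨C, hC⟩ := hbd
  obtain ⟨D, hD⟩ := hmertens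
  have hC0 : 0 ≤ C := by
    have := hC 1 le_rfl
    rw [hg1, Nat.cast_one, Real.one_rpow, mul_one] at this
    linarith
  have hβ : 1 / 2 < 1 - α := by linarith
  have ha0 : g 0 / ((0 : ℕ) : ℝ) = 0 := by simp
  have ha1 : g 1 / ((1 : ℕ) : ℝ) = 1 := by simp [hg1]
  have hmul' : ∀ m n : ℕ, Nat.Coprime m n →
      g (m * n) / ((m * n : ℕ) : ℝ) = g m / m * (g n / n) := fun m n h => by
    rw [hmul m n h, Nat.cast_mul, mul_div_mul_comm]
  have hnn' : ∀ n : ℕ, 0 ≤ g n / n := fun n => div_nonneg (hnn n) (Nat.cast_nonneg n)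
  have ha : ∀ n : ℕ, 1 ≤ n → g n / n ≤ C * (n : ℝ) ^ (-(1 - α)) := fun n hn => by
    have hn0 : (0 : ℝ) < n := by exact_mod_cast hn
    rw [neg_sub, Real.rpow_sub_one hn0.ne', ← mul_div_assoc]
    exact div_le_div_of_nonneg_right (hC n hn) hn0.le
  have hlog2 : 0 ≤ Real.log 2 := Real.log_nonneg one_le_two
  have hmer : ∀ w : ℝ, 1 ≤ w →
      |∑ p ∈ Ioc 0 ⌊w⌋₊ with p.Prime, g p / p * Real.log p - κ * Real.log w| ≤
        max D (κ * Real.log 2) := by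
    intro w hw
    rcases le_or_gt 2 w with h2 | h2
    · refine le_trans (le_of_eq ?_) ((hD w h2).trans (le_max_left _ _))
      congr 2
      refine Finset.sum_congr ?_ fun p _ => by ring
      ext p
      simp only [mem_filter, mem_Ioc, mem_range, Nat.lt_succ_iff]
      exact ⟨fun h => ⟨h.1.2, h.2⟩, fun h => ⟨⟨h.2.pos, h.1⟩, h.2⟩⟩
    · have hempty : (Ioc 0 ⌊w⌋₊).filter Nat.Prime = ∅ := by
        refine Finset.filter_eq_empty_iff.2 fun p hp hprime => ?_
        have h3 : ⌊w⌋₊ < 2 := (Nat.floor_lt (by linarith)).2 (by exact_mod_cast h2)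
        have := (mem_Ioc.1 hp).2
        have := hprime.two_le
        omega
      rw [hempty, Finset.sum_empty, zero_sub, abs_neg,
        abs_of_nonneg (mul_nonneg hκ (Real.log_nonneg hw))]
      exact (mul_le_mul_of_nonneg_left (Real.log_le_log (by linarith) h2.le) hκ).trans
        (le_max_right _ _)
  obtain ⟨c, K, h⟩ :=
    exists_abs_expSum_sub_le (a := fun n => g n / n) hκ hC0 hβ hmul' hnn' ha hmer
  refine ⟨c, ?_, K, fun x hx => ?_⟩
  · simpa only [Nat.cast_pow] using
      tendsto_prod_eulerFactor (a := fun n => g n / n) hκ hC0 hβ ha0 ha1 hmul' hnn' ha hmer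
        (tendsto_expSum_div_rpow h)
  · have := h (Real.log x) (Real.log_le_log two_pos hx)
    rwa [expSum, Real.exp_log (by linarith)] at this
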